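/- arXiv:1208.3213 — 2 statements merged into one kernel-verified Lean document; each statement's English description precedes it below -/
import Mathlib

section
/- Suppose there exists a σ-field 𝒳 ⊆ ℬ satisfying: (1) 𝒳 ⊆ T^{−1}𝒳; (2) ess sup_{u ∈ 𝕌_0} |E[ℓ_0(u) | 𝒴_{−∞,0} ∨ T^{−n}𝒳] − ℓ_0(u)| → 0 in L¹(P) and ess sup_{u ∈ 𝕌_0} |E[ℓ_0(u) | 𝒴_{−∞,0} ∨ T^{n}𝒳] − E[ℓ_0(u) | ⋂_{k=1}^∞ (𝒴_{−∞,0} ∨ T^{k}𝒳)]| → 0 in L¹(P) as n → ∞; (3) E[ess inf_{u ∈ 𝕌_0} E[ℓ_0(u) | 𝒴_{−∞,0}]] = E[ess inf_{u ∈ 𝕌_0} E[ℓ_0(u) | ⋂_{k=1}^∞ (𝒴_{−∞,0} ∨ T^{k}𝒳)]] =: L*. Then, with 𝒢_k^∞ := ⋂_{n} (𝒴_{−∞,k} ∨ T^{n−k}𝒳), for every admissible strategy u: (1/T) Σ_{k=1}^{T} (ℓ_k(u_k) − E[ℓ_k(u_k) | 𝒢_k^∞]) → 0 almost surely, and consequently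 liminf_{T→∞} L_T(u) ≥ L* almost surely. -/
open MeasureTheory Filter Set
open scoped ENNReal Topology symmDiff

noncomputable section

namespace ErgodicDecisions

variable {Ω U : Type*}

/-- The `ℤ`-indexed iterates of an invertible transformation `T` with inverse `S`:
`iter T S n = Tⁿ` for `n ≥ 0` and `iter T S (-n) = Sⁿ`. -/
def iter (T S : Ω → Ω) : ℤ → Ω → Ω
  | Int.ofNat n => T^[n]
  | Int.negSucc n => S^[n + 1]

variable {m0 : MeasurableSpace Ω} [mU : MeasurableSpace U]

/-- The observation σ-field `𝒴_{m,n} = ⋁_{k=m}^{n} T^{-k} 𝒴`. -/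
def obsField (T S : Ω → Ω) (Y : MeasurableSpace Ω) (m n : ℤ) : MeasurableSpace Ω :=
  ⨆ k ∈ Set.Icc m n, MeasurableSpace.comap (iter T S k) Y

/-- The observation σ-field `𝒴_{-∞,n} = ⋁_{k ≤ n} T^{-k} 𝒴`. -/
def obsFieldLE (T S : Ω → Ω) (Y : MeasurableSpace Ω) (n : ℤ) : MeasurableSpace Ω :=
  ⨆ k ∈ Set.Iic n, MeasurableSpace.comap (iter T S k) Y

/-- `𝕌_{m,n}`: the set of `𝒴_{m,n}`-measurable decision maps `Ω → U`. -/
def Umn (T S : Ω → Ω) (Y : MeasurableSpace Ω) (m n : ℤ) : Set (Ω → U) :=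
  {v | Measurable[obsField T S Y m n] v}

/-- `𝕌_n = ⋃_{m ≤ n} 𝕌_{m,n}`. -/
def Un (T S : Ω → Ω) (Y : MeasurableSpace Ω) (n : ℤ) : Set (Ω → U) :=
  ⋃ m ∈ Set.Iic n, Umn T S Y m n

/-- The loss at time `n` of the decision map `v`: `ℓ_n(v)(ω) = ℓ(v(ω), Tⁿω)`. -/
def lossAt (T S : Ω → Ω) (ℓ : U → Ω → ℝ) (n : ℤ) (v : Ω → U) (ω : Ω) : ℝ :=
  ℓ (v ω) (iter T S n ω)

/-- An admissible strategy: `u_k` is `𝒴_{0,k}`-measurable for every `k ≥ 1`. -/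
def Admissible (T S : Ω → Ω) (Y : MeasurableSpace Ω) (u : ℕ → Ω → U) : Prop :=
  ∀ k : ℕ, 1 ≤ k → u k ∈ Umn T S Y 0 (k : ℤ)

/-- The time-average loss `L_T(u) = T⁻¹ ∑_{k=1}^T ℓ_k(u_k)`. -/
def avgLoss (T S : Ω → Ω) (ℓ : U → Ω → ℝ) (u : ℕ → Ω → U) (n : ℕ) (ω : Ω) : ℝ :=
  (n : ℝ)⁻¹ * ∑ k ∈ Finset.Icc 1 n, lossAt T S ℓ (k : ℤ) (u k) ω

/-- `g` is an essential infimum (an a.e.-greatest lower bound among random variables)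
of the family `(f i)_{i ∈ S₀}` under `P`. -/
def IsEssInfFam {ι : Type*} (P : Measure Ω) (S₀ : Set ι) (f : ι → Ω → ℝ) (g : Ω → ℝ) : Prop :=
  Measurable[m0] g ∧ (∀ i ∈ S₀, ∀ᵐ ω ∂P, g ω ≤ f i ω) ∧
    ∀ h : Ω → ℝ, Measurable[m0] h → (∀ i ∈ S₀, ∀ᵐ ω ∂P, h ω ≤ f i ω) → ∀ᵐ ω ∂P, h ω ≤ g ω

/-- `g` is an essential supremum (an a.e.-least upper bound among random variables)
of the family `(f i)_{i ∈ S₀}` under `P`. -/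
def IsEssSupFam {ι : Type*} (P : Measure Ω) (S₀ : Set ι) (f : ι → Ω → ℝ) (g : Ω → ℝ) : Prop :=
  Measurable[m0] g ∧ (∀ i ∈ S₀, ∀ᵐ ω ∂P, f i ω ≤ g ω) ∧
    ∀ h : Ω → ℝ, Measurable[m0] h → (∀ i ∈ S₀, ∀ᵐ ω ∂P, f i ω ≤ h ω) → ∀ᵐ ω ∂P, g ω ≤ h ω

/-- A mean-optimal strategy in the sense of Lemma 2.5 of the paper:
`E[ℓ_k(ũ_k)|𝒴_{0,k}] ≤ ess inf_{u ∈ 𝕌_{0,k}} E[ℓ_k(u)|𝒴_{0,k}] + 1/k` a.s. for all `k ≥ 1`. -/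
def MeanOptimalStrategy (P : Measure Ω) (T S : Ω → Ω) (Y : MeasurableSpace Ω)
    (ℓ : U → Ω → ℝ) (ut : ℕ → Ω → U) : Prop :=
  Admissible T S Y ut ∧
    ∀ k : ℕ, 1 ≤ k → ∃ g : Ω → ℝ,
      IsEssInfFam P (Umn T S Y 0 (k : ℤ))
        (fun v => P[lossAt T S ℓ (k : ℤ) v | obsField T S Y 0 (k : ℤ)]) g ∧
      ∀ᵐ ω ∂P, (P[lossAt T S ℓ (k : ℤ) (ut k) | obsField T S Y 0 (k : ℤ)]) ω ≤ g ω + (k : ℝ)⁻¹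

/-- Pathwise optimality (Definition 2.2). -/
def PathwiseOptimal (P : Measure Ω) (T S : Ω → Ω) (Y : MeasurableSpace Ω)
    (ℓ : U → Ω → ℝ) (us : ℕ → Ω → U) : Prop :=
  Admissible T S Y us ∧
    ∀ u : ℕ → Ω → U, Admissible T S Y u →
      ∀ᵐ ω ∂P,
        0 ≤ Filter.liminf (fun n : ℕ => avgLoss T S ℓ u n ω - avgLoss T S ℓ us n ω) atTop

/-- Weak pathwise optimality (Definition 2.3). -/
def WeaklyPathwiseOptimal (P : Measure Ω) (T S : Ω → Ω) (Y : MeasurableSpace Ω)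
    (ℓ : U → Ω → ℝ) (us : ℕ → Ω → U) : Prop :=
  Admissible T S Y us ∧
    ∀ u : ℕ → Ω → U, Admissible T S Y u → ∀ ε : ℝ, 0 < ε →
      Tendsto (fun n : ℕ => P {ω | -ε ≤ avgLoss T S ℓ u n ω - avgLoss T S ℓ us n ω})
        atTop (𝓝 1)

/-- Mean optimality (Definition 2.4). -/
def MeanOptimal (P : Measure Ω) (T S : Ω → Ω) (Y : MeasurableSpace Ω)
    (ℓ : U → Ω → ℝ) (us : ℕ → Ω → U) : Prop :=
  Admissible T S Y us ∧
    ∀ u : ℕ → Ω → U, Admissible T S Y u →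
      0 ≤ Filter.liminf
        (fun n : ℕ => (∫ ω, avgLoss T S ℓ u n ω ∂P) - ∫ ω, avgLoss T S ℓ us n ω ∂P) atTop

/-- Two σ-fields on `Ω` agree modulo `P`-null sets. -/
def EqModP (P : Measure Ω) (m₁ m₂ : MeasurableSpace Ω) : Prop :=
  (∀ A : Set Ω, MeasurableSet[m₁] A → ∃ B : Set Ω, MeasurableSet[m₂] B ∧ P (A ∆ B) = 0) ∧
    ∀ A : Set Ω, MeasurableSet[m₂] A → ∃ B : Set Ω, MeasurableSet[m₁] B ∧ P (A ∆ B) = 0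

/-- Conditional K-automorphism relative to `Z` (Definition 1.4); `S` is the inverse of `T`,
so that `T^{-k}𝒳 = comap T^k 𝒳` and `T^{k}𝒳 = comap S^k 𝒳`. -/
def CondK (P : Measure Ω) (T S : Ω → Ω) (Z : MeasurableSpace Ω) : Prop :=
  ∃ X : MeasurableSpace Ω, X ≤ m0 ∧
    X ≤ MeasurableSpace.comap T X ∧
    EqModP P (⨆ k : ℕ, MeasurableSpace.comap (T^[k + 1]) X) m0 ∧
    EqModP P (⨅ k : ℕ, Z ⊔ MeasurableSpace.comap (S^[k + 1]) X) Z

/-- Conditional weak mixing relative to `Z` (Definition 1.3); `S` is the inverse of `T`,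
so that `T^k B = (S^[k])⁻¹ B`. -/
def CondWeakMixing (P : Measure Ω) (S : Ω → Ω) (Z : MeasurableSpace Ω) : Prop :=
  ∀ A B : Set Ω, MeasurableSet[m0] A → MeasurableSet[m0] B →
    Tendsto
      (fun n : ℕ => ∫ ω,
        (n : ℝ)⁻¹ * ∑ k ∈ Finset.Icc 1 n,
          |(P[(A ∩ S^[k] ⁻¹' B).indicator (fun _ => (1 : ℝ)) | Z]) ω -
            (P[A.indicator (fun _ => (1 : ℝ)) | Z]) ω *
              (P[(S^[k] ⁻¹' B).indicator (fun _ => (1 : ℝ)) | Z]) ω| ∂P)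
      atTop (𝓝 0)

/-- The tail σ-field `⋂_{k≥1} (𝒴_{-∞,0} ∨ T^k 𝒳)`. -/
def tailField (T S : Ω → Ω) (Y X : MeasurableSpace Ω) : MeasurableSpace Ω :=
  ⨅ k : ℕ, obsFieldLE T S Y 0 ⊔ MeasurableSpace.comap (S^[k + 1]) X

/-- The truncated loss `ℓ_0(v)·1_{Λ ≤ M}`. -/
def truncLoss (ℓ : U → Ω → ℝ) (Λ : Ω → ℝ) (M : ℝ) (v : Ω → U) (ω : Ω) : ℝ :=
  if Λ ω ≤ M then ℓ (v ω) ω else 0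

/-- `ℓ̄_0^M(v) = ℓ_0(v)·1_{Λ≤M} − E[ℓ_0(v)·1_{Λ≤M} | 𝒴_{-∞,0}]`. -/
def barLoss (P : Measure Ω) (T S : Ω → Ω) (Y : MeasurableSpace Ω)
    (ℓ : U → Ω → ℝ) (Λ : Ω → ℝ) (M : ℝ) (v : Ω → U) (ω : Ω) : ℝ :=
  truncLoss ℓ Λ M v ω - (P[truncLoss ℓ Λ M v | obsFieldLE T S Y 0]) ω

/-- The uniform conditional mixing assumption of Theorem 2.12:
`lim_{M→∞} limsup_{T→∞} E[(1/T)∑_{k=1}^T ess sup_{u,u'∈𝕌₀}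
|E[(ℓ̄₀^M(u)∘T^{-k})·ℓ̄₀^M(u')|𝒴_{-∞,0}]|] = 0`. -/
def UniformCondMixing (P : Measure Ω) (T S : Ω → Ω) (Y : MeasurableSpace Ω)
    (ℓ : U → Ω → ℝ) (Λ : Ω → ℝ) : Prop :=
  ∃ G : ℝ → ℕ → Ω → ℝ,
    (∀ (M : ℝ) (k : ℕ),
      IsEssSupFam P ((Un T S Y 0) ×ˢ (Un T S Y 0))
        (fun p ω =>
          |(P[(fun ω' => barLoss P T S Y ℓ Λ M p.1 (S^[k] ω') *
                barLoss P T S Y ℓ Λ M p.2 ω') | obsFieldLE T S Y 0]) ω|)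
        (G M k)) ∧
    Tendsto
      (fun M : ℝ =>
        Filter.limsup
          (fun n : ℕ => ∫ ω, (n : ℝ)⁻¹ * ∑ k ∈ Finset.Icc 1 n, G M k ω ∂P) atTop)
      atTop (𝓝 0)

/-- Equimeasurability of the loss (Definition 3.1): for every `ε > 0` there is a set of
probability at least `1-ε` on which the family `{ℓ(u,·) : u ∈ U}` is totally bounded
in `L^∞(P)`. -/
def Equimeasurable (P : Measure Ω) (ℓ : U → Ω → ℝ) : Prop :=
  ∀ ε : ℝ, 0 < ε → ∃ Ωε : Set Ω, MeasurableSet[m0] Ωε ∧ 1 - ENNReal.ofReal ε ≤ P Ωε ∧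
    ∀ δ : ℝ, 0 < δ → ∃ 𝒩 : Finset (Ω → ℝ), ∀ u : U, ∃ f ∈ 𝒩,
      eLpNorm (fun ω => Ωε.indicator (ℓ u) ω - f ω) ⊤ P ≤ ENNReal.ofReal δ



/-- Running maximum of the Birkhoff sums (started at `0`). -/
def runMax {Ω : Type*} (T : Ω → Ω) (f : Ω → ℝ) : ℕ → Ω → ℝ
  | 0 => fun _ => 0
  | n + 1 => fun ω => max 0 (f ω + runMax T f n (T ω))

lemma runMax_nonneg {Ω : Type*} (T : Ω → Ω) (f : Ω → ℝ) (n : ℕ) (ω : Ω) : 0 ≤ runMax T f n ω := by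
  cases n with
  | zero => simp [runMax]
  | succ n => simp [runMax]

lemma runMax_mono {Ω : Type*} (T : Ω → Ω) (f : Ω → ℝ) (n : ℕ) :
    ∀ ω : Ω, runMax T f n ω ≤ runMax T f (n + 1) ω := by
  induction n with
  | zero => intro ω; simp [runMax]
  | succ n ih =>
    intro ω
    have := ih (T ω)
    simp only [runMax] at this ⊢
    gcongr

lemma sum_le_runMax {Ω : Type*} (T : Ω → Ω) (f : Ω → ℝ) (n : ℕ) :
    ∀ ω : Ω, ∑ k ∈ Finset.range n, f (T^[k] ω) ≤ runMax T f n ω := by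
  induction n with
  | zero => intro ω; simp [runMax]
  | succ n ih =>
    intro ω
    rw [Finset.sum_range_succ']
    have := ih (T ω)
    simp only [runMax, Function.iterate_succ, Function.comp_apply, Function.iterate_zero, id] at this ⊢
    refine le_max_of_le_right ?_
    linarith

lemma runMax_meas {Ω : Type*} [m0 : MeasurableSpace Ω] {T : Ω → Ω} (hT : Measurable T) {f : Ω → ℝ}
    (hf : Measurable f) (n : ℕ) : Measurable (runMax T f n) := by
  induction n with
  | zero => exact measurable_const
  | succ n ih => exact measurable_const.max (hf.add (ih.comp hT))

lemma runMax_int {Ω : Type*} [m0 : MeasurableSpace Ω] {P : Measure Ω} [IsProbabilityMeasure P]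
    {T : Ω → Ω} (hT : MeasurePreserving T P P) {f : Ω → ℝ}
    (hf : Integrable f P) (n : ℕ) : Integrable (runMax T f n) P := by
  induction n with
  | zero => exact integrable_zero _ _ _
  | succ n ih =>
    exact (integrable_zero _ _ _).sup (hf.add (hT.integrable_comp_of_integrable ih))

lemma birkhoff_bdd {Ω : Type*} [m0 : MeasurableSpace Ω] {P : Measure Ω} [IsProbabilityMeasure P]
    {T : Ω → Ω} (hT : Ergodic T P) {f : Ω → ℝ} (hfm : Measurable f)
    (hf : Integrable f P) (hneg : ∫ ω, f ω ∂P < 0) :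
    ∀ᵐ ω ∂P, ∃ C : ℝ, ∀ n : ℕ, ∑ k ∈ Finset.range n, f (T^[k] ω) ≤ C := by
  have hTm := hT.toMeasurePreserving
  set A : Set Ω := {ω | ∀ N : ℕ, ∃ n : ℕ, (N : ℝ) < runMax T f n ω} with hA
  have hAm : MeasurableSet A := by
    have : A = ⋂ N : ℕ, ⋃ n : ℕ, {ω | (N : ℝ) < runMax T f n ω} := by
      ext ω; simp [hA]
    rw [this]
    exact MeasurableSet.iInter fun N => MeasurableSet.iUnion fun n =>
      measurableSet_lt measurable_const (runMax_meas hT.measurable hfm n)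
  have hAinv : T ⁻¹' A = A := by
    ext ω
    simp only [hA, mem_preimage, mem_ofPred_eq]
    constructor
    · intro h N
      obtain ⟨K, hK⟩ := exists_nat_gt ((N : ℝ) - f ω)
      obtain ⟨n, hn⟩ := h K
      refine ⟨n + 1, ?_⟩
      simp only [runMax]
      refine lt_max_of_lt_right ?_
      linarith
    · intro h N
      obtain ⟨K, hK⟩ := exists_nat_gt ((N : ℝ) + |f ω|)
      obtain ⟨n, hn⟩ := h K
      refine ⟨n, ?_⟩
      have h1 := runMax_mono T f n ω
      simp only [runMax] at h1
      have h2 := neg_abs_le (f ω)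
      have h3 := le_abs_self (f ω)
      have h5 : (0 : ℝ) ≤ N := Nat.cast_nonneg N
      have h6 := abs_nonneg (f ω)
      have h4 : (K : ℝ) < f ω + runMax T f n (T ω) := by
        rcases lt_max_iff.1 (hn.trans_le h1) with h | h
        · linarith
        · exact h
      linarith
  rcases hT.toPreErgodic.ae_empty_or_univ hAm hAinv with h0 | h1
  · have h0' : ∀ᵐ ω ∂P, ω ∉ A := by
      filter_upwards [h0] with ω hω hωA
      exact (hω.mp hωA : ω ∈ (∅ : Set Ω))
    filter_upwards [h0'] with ω hω
    simp only [hA, mem_ofPred_eq, not_forall, not_exists, not_lt] at hω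
    obtain ⟨N, hN⟩ := hω
    exact ⟨N, fun n => (sum_le_runMax T f n ω).trans (hN n)⟩
  · exfalso
    have h1' : ∀ᵐ ω ∂P, T ω ∈ A := by
      filter_upwards [h1] with ω hω
      have : ω ∈ A := hω.mpr (mem_univ ω)
      rw [← hAinv] at this
      exact this
    have hlim : Tendsto (fun n : ℕ => ∫ ω, (runMax T f (n + 1) ω - runMax T f n (T ω)) ∂P)
        atTop (𝓝 (∫ ω, f ω ∂P)) := by
      refine tendsto_integral_of_dominated_convergence (fun ω => |f ω|) ?_ hf.abs ?_ ?_
      · intro n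
        exact ((runMax_meas hT.measurable hfm _).sub
          ((runMax_meas hT.measurable hfm _).comp hT.measurable)).aestronglyMeasurable
      · intro n
        refine Eventually.of_forall fun ω => ?_
        have h0 := runMax_nonneg T f n (T ω)
        simp only [runMax, Real.norm_eq_abs]
        rw [abs_le]
        rcases max_cases 0 (f ω + runMax T f n (T ω)) with h | h <;> rw [h.1] <;>
          constructor <;> cases abs_cases (f ω) <;> linarith
      · filter_upwards [h1'] with ω hω
        obtain ⟨K, hK⟩ := exists_nat_gt (- f ω)
        obtain ⟨n, hn⟩ := hω K
        have hmono : Monotone fun n => runMax T f n (T ω) :=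
          monotone_nat_of_le_succ fun n => runMax_mono T f n (T ω)
        refine tendsto_const_nhds.congr' ?_
        filter_upwards [eventually_ge_atTop n] with j hj
        have := hmono hj
        simp only at this
        simp only [runMax]
        rw [max_eq_right (by linarith)]
        ring
    refine absurd (ge_of_tendsto' hlim (b := 0) fun n => ?_) (not_le.2 hneg)
    have hcomp : Integrable (fun ω => runMax T f n (T ω)) P :=
      hTm.integrable_comp_of_integrable (runMax_int hTm hf n)
    rw [integral_sub (runMax_int hTm hf _) hcomp]
    have e : ∫ ω, runMax T f n (T ω) ∂P = ∫ ω, runMax T f n ω ∂P := by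
      conv_rhs => rw [← hTm.map_eq]
      rw [integral_map hT.measurable.aemeasurable]
      exact (runMax_meas hT.measurable hfm n).aestronglyMeasurable
    rw [e, sub_nonneg]
    exact integral_mono (runMax_int hTm hf _) (runMax_int hTm hf _) (runMax_mono T f n)

/-- Cesàro averages. -/
def av (a : ℕ → ℝ) (N : ℕ) : ℝ := (N : ℝ)⁻¹ * ∑ k ∈ Finset.Icc 1 N, a k

lemma av_mono {a b : ℕ → ℝ} (h : ∀ k, a k ≤ b k) (N : ℕ) : av a N ≤ av b N := by
  unfold av; gcongr with k; exact h k

lemma av_mono' {a b : ℕ → ℝ} (h : ∀ k, 1 ≤ k → a k ≤ b k) (N : ℕ) : av a N ≤ av b N := by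
  unfold av; gcongr with k hk; exact h k (Finset.mem_Icc.1 hk).1

lemma av_add (a b : ℕ → ℝ) (N : ℕ) : av (fun k => a k + b k) N = av a N + av b N := by
  unfold av; rw [Finset.sum_add_distrib, mul_add]

lemma av_neg (a : ℕ → ℝ) (N : ℕ) : av (fun k => - a k) N = - av a N := by
  unfold av; rw [Finset.sum_neg_distrib, mul_neg]

lemma birkhoff_upper {Ω : Type*} [m0 : MeasurableSpace Ω] {P : Measure Ω} [IsProbabilityMeasure P]
    {T : Ω → Ω} (hT : Ergodic T P) {f : Ω → ℝ}
    (hf : Integrable f P) (c : ℝ) (hc : ∫ ω, f ω ∂P < c) :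
    ∀ᵐ ω ∂P, ∀ᶠ N in atTop, av (fun k => f (T^[k] ω)) N ≤ c := by
  obtain ⟨c', h1, h2⟩ := exists_between hc
  set f' := hf.1.mk f with hf'
  have hfe : f =ᵐ[P] f' := hf.1.ae_eq_mk
  have hi' : Integrable f' P := hf.congr hfe
  have hm' : Measurable f' := hf.1.stronglyMeasurable_mk.measurable
  have key := birkhoff_bdd hT (f := fun ω => f' ω - c') (hm'.sub measurable_const)
    (hi'.sub (integrable_const _)) (by
      rw [integral_sub hi' (integrable_const _), ← integral_congr_ae hfe]; simp; linarith)
  have key' := hT.toMeasurePreserving.quasiMeasurePreserving.ae key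
  have hall : ∀ᵐ ω ∂P, ∀ k : ℕ, f (T^[k] ω) = f' (T^[k] ω) :=
    ae_all_iff.2 fun k => (hT.toMeasurePreserving.iterate k).quasiMeasurePreserving.ae hfe
  filter_upwards [key', hall] with ω ⟨C, hC⟩ hω
  have hlim : Tendsto (fun N : ℕ => c' + C * (N : ℝ)⁻¹) atTop (𝓝 (c' + C * 0)) :=
    tendsto_const_nhds.add (tendsto_const_nhds.mul tendsto_inv_atTop_nhds_zero_nat)
  have hev := hlim.eventually (eventually_le_nhds (b := c) (by simpa using h2))
  filter_upwards [hev, eventually_gt_atTop 0] with N hN hN0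
  refine le_trans ?_ hN
  have h3 := hC N
  have h4 : ∑ k ∈ Finset.Icc 1 N, f (T^[k] ω) = ∑ k ∈ Finset.range N, f' (T^[k] (T ω)) := by
    have hI : Finset.Icc 1 N = Finset.Ico (0 + 1) (N + 1) := by ext x; simp
    rw [hI, Finset.range_eq_Ico, ← Finset.sum_Ico_add' (fun k => f (T^[k] ω)) 0 N 1]
    refine Finset.sum_congr rfl fun k _ => ?_
    rw [hω, Function.iterate_succ_apply]
  have h5 : ∑ k ∈ Finset.Icc 1 N, f (T^[k] ω) ≤ C + N * c' := by
    rw [h4]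
    rw [Finset.sum_sub_distrib] at h3
    simp at h3
    linarith
  have hNpos : (0 : ℝ) < N := by exact_mod_cast hN0
  unfold av
  calc (N : ℝ)⁻¹ * ∑ k ∈ Finset.Icc 1 N, f (T^[k] ω) ≤ (N : ℝ)⁻¹ * (C + N * c') := by gcongr
    _ = c' + C * (N : ℝ)⁻¹ := by field_simp; ring

lemma birkhoff {Ω : Type*} [m0 : MeasurableSpace Ω] {P : Measure Ω} [IsProbabilityMeasure P]
    {T : Ω → Ω} (hT : Ergodic T P) {f : Ω → ℝ} (hf : Integrable f P) :
    ∀ᵐ ω ∂P, Tendsto (av (fun k => f (T^[k] ω))) atTop (𝓝 (∫ ω, f ω ∂P)) := by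
  have h1 : ∀ᵐ ω ∂P, ∀ n : ℕ, ∀ᶠ N in atTop,
      av (fun k => f (T^[k] ω)) N ≤ (∫ ω, f ω ∂P) + 1 / ((n : ℝ) + 1) :=
    ae_all_iff.2 fun n => birkhoff_upper hT hf _ (by
      have : 0 < 1 / ((n : ℝ) + 1) := Nat.one_div_pos_of_nat
      linarith)
  have h2 : ∀ᵐ ω ∂P, ∀ n : ℕ, ∀ᶠ N in atTop,
      av (fun k => (- f (T^[k] ω))) N ≤ (∫ ω, - f ω ∂P) + 1 / ((n : ℝ) + 1) :=
    ae_all_iff.2 fun n => birkhoff_upper hT hf.neg _ (by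
      have : 0 < 1 / ((n : ℝ) + 1) := Nat.one_div_pos_of_nat
      simp only [Pi.neg_apply]
      linarith)
  filter_upwards [h1, h2] with ω h1 h2
  rw [Metric.tendsto_atTop']
  intro ε hε
  obtain ⟨n, hn⟩ := exists_nat_one_div_lt hε
  obtain ⟨N, hN⟩ := eventually_atTop.1 ((h1 n).and (h2 n))
  refine ⟨N, fun M hM => ?_⟩
  obtain ⟨a, b⟩ := hN M hM.le
  rw [av_neg, integral_neg] at b
  rw [Real.dist_eq, abs_lt]
  constructor <;> linarith

lemma approx {Ω : Type*} [m0 : MeasurableSpace Ω] {P : Measure Ω} [IsProbabilityMeasure P]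
    {T : Ω → Ω} (hT : Ergodic T P) (Z : ℕ → Ω → ℝ)
    (h : ∀ ε : ℝ, 0 < ε → ∃ W : ℕ → Ω → ℝ, ∃ f : Ω → ℝ, Integrable f P ∧ ∫ ω, f ω ∂P < ε ∧
      (∀ᵐ ω ∂P, Tendsto (av (fun k => W k ω)) atTop (𝓝 0)) ∧
      ∀ k, 1 ≤ k → ∀ᵐ ω ∂P, |Z k ω - W k ω| ≤ f (T^[k] ω)) :
    ∀ᵐ ω ∂P, Tendsto (av (fun k => Z k ω)) atTop (𝓝 0) := by
  choose W f hfi hfs hW hZ using fun n : ℕ => h (1 / ((n : ℝ) + 1)) Nat.one_div_pos_of_nat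
  have h1 := ae_all_iff.2 hW
  have h2 : ∀ᵐ ω ∂P, ∀ n k, 1 ≤ k → |Z k ω - W n k ω| ≤ f n (T^[k] ω) := by
    refine ae_all_iff.2 fun n => ae_all_iff.2 fun k => ?_
    by_cases hk : 1 ≤ k
    · filter_upwards [hZ n k hk] with ω hω _ using hω
    · exact Eventually.of_forall fun ω h => absurd h hk
  have h3 := ae_all_iff.2 fun n => birkhoff hT (hfi n)
  filter_upwards [h1, h2, h3] with ω h1 h2 h3
  rw [Metric.tendsto_atTop']
  intro ε hε
  obtain ⟨n, hn⟩ := exists_nat_one_div_lt (half_pos hε)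
  have e1 := (h3 n).eventually (eventually_lt_nhds (hfs n))
  have e2 := Metric.tendsto_atTop'.1 (h1 n) (ε / 2) (half_pos hε)
  obtain ⟨N1, hN1⟩ := eventually_atTop.1 e1
  obtain ⟨N2, hN2⟩ := e2
  refine ⟨max N1 N2, fun M hM => ?_⟩
  have a := hN1 M ((le_max_left _ _).trans hM.le)
  have b := hN2 M ((le_max_right _ _).trans_lt hM)
  rw [Real.dist_eq, sub_zero] at b ⊢
  have up : av (fun k => Z k ω) M ≤ av (fun k => W n k ω) M + av (fun k => f n (T^[k] ω)) M := by
    rw [← av_add]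
    refine av_mono' (fun k hk => ?_) M
    have := (abs_le.1 (h2 n k hk)).2
    linarith
  have lo : av (fun k => W n k ω) M ≤ av (fun k => Z k ω) M + av (fun k => f n (T^[k] ω)) M := by
    rw [← av_add]
    refine av_mono' (fun k hk => ?_) M
    have := (abs_le.1 (h2 n k hk)).1
    linarith
  rw [abs_lt] at b ⊢
  constructor <;> linarith [b.1, b.2]

lemma av_fill {d : ℕ → ℝ} {C : ℝ} (hd : ∀ k, 1 ≤ k → |d k| ≤ C)
    (h : Tendsto (fun n : ℕ => av d (n ^ 2)) atTop (𝓝 0)) : Tendsto (av d) atTop (𝓝 0) := by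
  have hC : 0 ≤ C := (abs_nonneg _).trans (hd 1 le_rfl)
  have hsq : Tendsto Nat.sqrt atTop atTop := by
    refine tendsto_atTop.2 fun b => ?_
    filter_upwards [eventually_ge_atTop (b * b)] with N hN
    exact Nat.le_sqrt.2 hN
  have hb : Tendsto (fun n : ℕ => |av d (n ^ 2)| + 2 * C * (n : ℝ)⁻¹) atTop (𝓝 0) := by
    have := h.abs.add ((tendsto_inv_atTop_nhds_zero_nat (𝕜 := ℝ)).const_mul (2 * C))
    simpa using this
  refine squeeze_zero_norm' ?_ (hb.comp hsq)
  filter_upwards [eventually_ge_atTop 1] with N hN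
  simp only [Function.comp_apply, Real.norm_eq_abs]
  set n := Nat.sqrt N with hn
  have h1 : n ^ 2 ≤ N := by rw [pow_two]; exact Nat.sqrt_le N
  have h2 : N ≤ n ^ 2 + 2 * n := by
    have := Nat.sqrt_le_add N
    rw [← hn] at this
    nlinarith
  have hn0 : 1 ≤ n := Nat.le_sqrt.2 (by simpa using hN)
  have hn0' : (0 : ℝ) < n := by exact_mod_cast hn0
  have hN0' : (0 : ℝ) < N := by exact_mod_cast hN
  have h1' : (n : ℝ) ^ 2 ≤ N := by exact_mod_cast h1
  have h2' : (N : ℝ) ≤ n ^ 2 + 2 * n := by exact_mod_cast h2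
  have hsplit : ∑ k ∈ Finset.Icc 1 N, d k
      = ∑ k ∈ Finset.Icc 1 (n ^ 2), d k + ∑ k ∈ Finset.Ioc (n ^ 2) N, d k := by
    rw [← Finset.sum_union]
    · congr 1
      ext x
      simp only [Finset.mem_Icc, Finset.mem_union, Finset.mem_Ioc]
      omega
    · rw [Finset.disjoint_left]
      intro x hx hx'
      simp only [Finset.mem_Icc, Finset.mem_Ioc] at hx hx'
      omega
  have hrem : |∑ k ∈ Finset.Ioc (n ^ 2) N, d k| ≤ 2 * n * C := by
    calc |∑ k ∈ Finset.Ioc (n ^ 2) N, d k| ≤ ∑ k ∈ Finset.Ioc (n ^ 2) N, |d k| :=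
          Finset.abs_sum_le_sum_abs _ _
      _ ≤ ∑ k ∈ Finset.Ioc (n ^ 2) N, C := by
          refine Finset.sum_le_sum fun k hk => hd k ?_
          have := (Finset.mem_Ioc.1 hk).1
          omega
      _ = ((N - n ^ 2 : ℕ) : ℝ) * C := by simp
      _ ≤ 2 * n * C := by
          gcongr
          rw [Nat.cast_sub h1]
          push_cast
          linarith
  have hmain : |∑ k ∈ Finset.Icc 1 (n ^ 2), d k| = (n : ℝ) ^ 2 * |av d (n ^ 2)| := by
    unfold av
    rw [abs_mul, abs_of_nonneg (by positivity : (0 : ℝ) ≤ ((n ^ 2 : ℕ) : ℝ)⁻¹)]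
    push_cast
    field_simp
  have htot : |∑ k ∈ Finset.Icc 1 N, d k| ≤ (n : ℝ) ^ 2 * |av d (n ^ 2)| + 2 * n * C := by
    rw [hsplit, ← hmain]
    exact (abs_add_le _ _).trans (by gcongr)
  have e : |av d N| = (N : ℝ)⁻¹ * |∑ k ∈ Finset.Icc 1 N, d k| := by
    unfold av
    rw [abs_mul, abs_of_nonneg (by positivity : (0 : ℝ) ≤ (N : ℝ)⁻¹)]
  rw [e]
  calc (N : ℝ)⁻¹ * |∑ k ∈ Finset.Icc 1 N, d k|
      ≤ ((n : ℝ) ^ 2)⁻¹ * ((n : ℝ) ^ 2 * |av d (n ^ 2)| + 2 * n * C) := by gcongr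
    _ = |av d (n ^ 2)| + 2 * C * (n : ℝ)⁻¹ := by field_simp

lemma orth_lln {Ω : Type*} [m0 : MeasurableSpace Ω] {P : Measure Ω} [IsProbabilityMeasure P]
    (D : ℕ → Ω → ℝ) (C : ℝ) (hD : ∀ k, AEStronglyMeasurable (D k) P)
    (hC : ∀ k, 1 ≤ k → ∀ᵐ ω ∂P, |D k ω| ≤ C)
    (horth : ∀ i j, 1 ≤ i → i < j → ∫ ω, D i ω * D j ω ∂P = 0) :
    ∀ᵐ ω ∂P, Tendsto (av (fun k => D k ω)) atTop (𝓝 0) := by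
  have hall : ∀ᵐ ω ∂P, ∀ k, 1 ≤ k → |D k ω| ≤ C := by
    refine ae_all_iff.2 fun k => ?_
    by_cases hk : 1 ≤ k
    · filter_upwards [hC k hk] with ω hω _ using hω
    · exact Eventually.of_forall fun ω h => absurd h hk
  have hprod : ∀ i j, 1 ≤ i → 1 ≤ j → Integrable (fun ω => D i ω * D j ω) P := by
    intro i j hi hj
    refine Integrable.of_bound ((hD i).mul (hD j)) (C * C) ?_
    filter_upwards [hC i hi, hC j hj] with ω h1 h2
    rw [Real.norm_eq_abs, abs_mul]
    have := abs_nonneg (D i ω)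
    gcongr
    linarith
  have hsqint : ∀ N : ℕ, Integrable (fun ω => (∑ k ∈ Finset.Icc 1 N, D k ω) ^ 2) P ∧
      ∫ ω, (∑ k ∈ Finset.Icc 1 N, D k ω) ^ 2 ∂P ≤ N * C ^ 2 := by
    intro N
    have e : (fun ω => (∑ k ∈ Finset.Icc 1 N, D k ω) ^ 2) =
        fun ω => ∑ i ∈ Finset.Icc 1 N, ∑ j ∈ Finset.Icc 1 N, D i ω * D j ω := by
      funext ω
      rw [pow_two, Finset.sum_mul_sum]
    rw [e]
    have hint : ∀ i ∈ Finset.Icc 1 N, ∀ j ∈ Finset.Icc 1 N,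
        Integrable (fun ω => D i ω * D j ω) P := fun i hi j hj =>
      hprod i j (Finset.mem_Icc.1 hi).1 (Finset.mem_Icc.1 hj).1
    refine ⟨integrable_finsetSum _ fun i hi => integrable_finsetSum _ fun j hj => hint i hi j hj, ?_⟩
    rw [integral_finsetSum _ fun i hi => integrable_finsetSum _ fun j hj => hint i hi j hj]
    calc ∑ i ∈ Finset.Icc 1 N, ∫ ω, ∑ j ∈ Finset.Icc 1 N, D i ω * D j ω ∂P
        = ∑ i ∈ Finset.Icc 1 N, ∫ ω, D i ω * D i ω ∂P := by
          refine Finset.sum_congr rfl fun i hi => ?_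
          rw [integral_finsetSum _ fun j hj => hint i hi j hj]
          refine Finset.sum_eq_single_of_mem i hi fun j hj hji => ?_
          rcases lt_or_gt_of_ne hji with h | h
          · rw [← horth j i (Finset.mem_Icc.1 hj).1 h]
            exact integral_congr_ae (Eventually.of_forall fun ω => mul_comm _ _)
          · exact horth i j (Finset.mem_Icc.1 hi).1 h
      _ ≤ ∑ i ∈ Finset.Icc 1 N, C ^ 2 := by
          refine Finset.sum_le_sum fun i hi => ?_
          have : ∫ ω, D i ω * D i ω ∂P ≤ ∫ ω, C ^ 2 ∂P := by
            refine integral_mono_ae (hint i hi i hi) (integrable_const _) ?_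
            filter_upwards [hC i (Finset.mem_Icc.1 hi).1] with ω hω
            have := abs_nonneg (D i ω)
            rw [← abs_mul_abs_self]
            nlinarith
          simpa using this
      _ = N * C ^ 2 := by simp
  have hZ : ∀ n : ℕ, ∫⁻ ω, ENNReal.ofReal ((av (fun k => D k ω) ((n + 1) ^ 2)) ^ 2) ∂P ≤
      ENNReal.ofReal (C ^ 2 * (1 / ((n : ℝ) + 1) ^ 2)) := by
    intro n
    obtain ⟨hi, hb⟩ := hsqint ((n + 1) ^ 2)
    have e : (fun ω => (av (fun k => D k ω) ((n + 1) ^ 2)) ^ 2) =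
        fun ω => ((((n + 1) ^ 2 : ℕ) : ℝ)⁻¹) ^ 2 * (∑ k ∈ Finset.Icc 1 ((n + 1) ^ 2), D k ω) ^ 2 := by
      funext ω; unfold av; rw [mul_pow]
    rw [← ofReal_integral_eq_lintegral_ofReal (by rw [e]; exact hi.const_mul _)
      (Eventually.of_forall fun ω => sq_nonneg _)]
    refine ENNReal.ofReal_le_ofReal ?_
    rw [e, integral_const_mul]
    calc _ ≤ ((((n + 1) ^ 2 : ℕ) : ℝ)⁻¹) ^ 2 * ((((n + 1) ^ 2 : ℕ) : ℝ) * C ^ 2) := by gcongr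
      _ = _ := by push_cast; field_simp
  have hsum : Summable fun n : ℕ => C ^ 2 * (1 / ((n : ℝ) + 1) ^ 2) := by
    have h := (summable_nat_add_iff 1).2 (Real.summable_one_div_nat_pow.2 (by norm_num : 1 < 2))
    simpa using h.mul_left (C ^ 2)
  have hmeas : ∀ n : ℕ, AEMeasurable
      (fun ω => ENNReal.ofReal ((av (fun k => D k ω) ((n + 1) ^ 2)) ^ 2)) P := by
    intro n
    refine AEMeasurable.ennreal_ofReal (AEMeasurable.pow_const ?_ 2)
    unfold av
    refine AEMeasurable.const_mul ?_ _
    exact Finset.aemeasurable_fun_sum _ fun k _ => (hD k).aemeasurable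
  have hfin : ∫⁻ ω, ∑' n : ℕ, ENNReal.ofReal ((av (fun k => D k ω) ((n + 1) ^ 2)) ^ 2) ∂P ≠ ∞ := by
    rw [lintegral_tsum hmeas]
    refine ne_top_of_le_ne_top ?_ (ENNReal.tsum_le_tsum hZ)
    exact hsum.tsum_ofReal_ne_top
  have hae := ae_lt_top' (AEMeasurable.tsum hmeas) hfin
  filter_upwards [hall, hae] with ω h1 h2
  refine av_fill h1 ?_
  have h3 := ENNReal.tendsto_atTop_zero_of_tsum_ne_top h2.ne
  rw [← tendsto_add_atTop_iff_nat 1]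
  have h4 := (ENNReal.tendsto_toReal ENNReal.zero_ne_top).comp h3
  have h5 : Tendsto (fun n : ℕ => (av (fun k => D k ω) ((n + 1) ^ 2)) ^ 2) atTop (𝓝 0) := by
    refine h4.congr fun n => ?_
    simp only [Function.comp_apply]
    exact ENNReal.toReal_ofReal (sq_nonneg _)
  have h6 := h5.sqrt
  simp only [Real.sqrt_sq_eq_abs, Real.sqrt_zero] at h6
  exact (tendsto_zero_iff_abs_tendsto_zero _).2 h6

lemma condExp_transport {Ω : Type*} {m : MeasurableSpace Ω} [m0 : MeasurableSpace Ω] {P : Measure Ω}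
    [IsProbabilityMeasure P] {φ : Ω → Ω} (hφ : MeasurePreserving φ P P)
    (hm : m ≤ m0) {f : Ω → ℝ} (hf : Integrable f P) :
    (P[f | m]) ∘ φ =ᵐ[P] P[f ∘ φ | MeasurableSpace.comap φ m] := by
  have hm' : MeasurableSpace.comap φ m ≤ m0 := by
    rintro s ⟨t, ht, rfl⟩
    exact hφ.measurable (hm t ht)
  refine ae_eq_condExp_of_forall_setIntegral_eq hm' (hφ.integrable_comp_of_integrable hf) ?_ ?_ ?_
  · intro s _ _
    exact (hφ.integrable_comp_of_integrable integrable_condExp).integrableOn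
  · rintro s ⟨t, ht, rfl⟩ _
    have aux : ∀ g : Ω → ℝ, Integrable g P →
        ∫ x in φ ⁻¹' t, (g ∘ φ) x ∂P = ∫ x in t, g x ∂P := by
      intro g hg
      have h1 : (P.restrict (φ ⁻¹' t)).map φ = P.restrict t := by
        rw [← Measure.restrict_map hφ.measurable (hm t ht), hφ.map_eq]
      rw [← h1, integral_map hφ.measurable.aemeasurable]
      · rfl
      · rw [h1]; exact hg.1.restrict
    rw [aux _ integrable_condExp, aux _ hf, setIntegral_condExp hm hf ht]
  · refine StronglyMeasurable.aestronglyMeasurable ?_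
    exact (stronglyMeasurable_condExp (m := m)).comp_measurable (comap_measurable φ)

lemma condExp_close {Ω : Type*} {m : MeasurableSpace Ω} [m0 : MeasurableSpace Ω] {P : Measure Ω}
    {a b g : Ω → ℝ} (ha : Integrable a P) (hb : Integrable b P) (hg : Integrable g P)
    (h : ∀ᵐ ω ∂P, |a ω - b ω| ≤ g ω) :
    ∀ᵐ ω ∂P, |(P[a | m]) ω - (P[b | m]) ω| ≤ (P[g | m]) ω := by
  have h1 : P[a | m] ≤ᵐ[P] P[b + g | m] := by
    refine condExp_mono ha (hb.add hg) ?_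
    filter_upwards [h] with ω hω
    have := (abs_le.1 hω).2
    simp only [Pi.add_apply]; linarith
  have h2 : P[b | m] ≤ᵐ[P] P[a + g | m] := by
    refine condExp_mono hb (ha.add hg) ?_
    filter_upwards [h] with ω hω
    have := (abs_le.1 hω).1
    simp only [Pi.add_apply]; linarith
  filter_upwards [h1, h2, condExp_add hb hg m, condExp_add ha hg m] with ω h1 h2 h3 h4
  rw [h3] at h1
  rw [h4] at h2
  simp only [Pi.add_apply] at h1 h2
  rw [abs_le]
  constructor <;> linarith

lemma tail_small {Ω : Type*} [m0 : MeasurableSpace Ω] {P : Measure Ω} {L : Ω → ℝ}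
    (hL : Integrable L P) (ε : ℝ) (hε : 0 < ε) :
    ∃ M : ℕ, ∫ ω, max 0 (L ω - M) ∂P < ε := by
  have hlim : Tendsto (fun M : ℕ => ∫ ω, max 0 (L ω - M) ∂P) atTop (𝓝 (∫ _, (0 : ℝ) ∂P)) := by
    refine tendsto_integral_of_dominated_convergence (fun ω => |L ω|) ?_ hL.abs ?_ ?_
    · intro n
      exact aestronglyMeasurable_const.sup (hL.1.sub aestronglyMeasurable_const)
    · intro n
      refine Eventually.of_forall fun ω => ?_
      have h5 : (0 : ℝ) ≤ n := Nat.cast_nonneg n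
      rw [Real.norm_eq_abs, abs_of_nonneg (le_max_left _ _)]
      refine max_le (abs_nonneg _) ?_
      linarith [le_abs_self (L ω)]
    · refine Eventually.of_forall fun ω => ?_
      obtain ⟨K, hK⟩ := exists_nat_gt (L ω)
      refine tendsto_const_nhds.congr' ?_
      filter_upwards [eventually_ge_atTop K] with j hj
      have : (K : ℝ) ≤ j := by exact_mod_cast hj
      rw [max_eq_left (by linarith)]
  rw [integral_zero] at hlim
  exact (hlim.eventually (eventually_lt_nhds hε)).exists

/-- Clipping at level `M`. -/
def clip (M x : ℝ) : ℝ := max (-M) (min M x)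

lemma clip_abs {M : ℝ} (hM : 0 ≤ M) (x : ℝ) : |clip M x| ≤ M := by
  unfold clip
  rw [abs_le]
  exact ⟨le_max_left _ _, max_le (by linarith) (min_le_left _ _)⟩

lemma clip_close {M : ℝ} (hM : 0 ≤ M) (x L : ℝ) (h : |x| ≤ L) :
    |x - clip M x| ≤ max 0 (L - M) := by
  unfold clip
  obtain ⟨h1, h2⟩ := abs_le.1 h
  rw [abs_le]
  rcases max_cases (-M) (min M x) with h3 | h3 <;> rcases min_cases M x with h4 | h4 <;>
    rcases max_cases 0 (L - M) with h5 | h5 <;> constructor <;> linarith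

lemma step {Ω : Type*} (F F' : ℕ → MeasurableSpace Ω) [m0 : MeasurableSpace Ω] {P : Measure Ω}
    [IsProbabilityMeasure P] {T : Ω → Ω} (hT : Ergodic T P)
    (hFm : ∀ k, F k ≤ m0) (hF' : ∀ k, F' k ≤ F k) (hmono : ∀ i k, i < k → F i ≤ F' k)
    (hF0 : ∀ k, F k = MeasurableSpace.comap (T^[k]) (F 0))
    (hF0' : ∀ k, F' k = MeasurableSpace.comap (T^[k]) (F' 0))
    (c : ℕ → Ω → ℝ) (hc : ∀ k, 1 ≤ k → Measurable (c k))
    (L : Ω → ℝ) (hL : Integrable L P) (hcL : ∀ k ω, 1 ≤ k → |c k ω| ≤ L (T^[k] ω)) :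
    ∀ᵐ ω ∂P, Tendsto (av (fun k => (P[c k | F k]) ω - (P[c k | F' k]) ω)) atTop (𝓝 0) := by
  refine approx hT (fun k ω => (P[c k | F k]) ω - (P[c k | F' k]) ω) fun ε hε => ?_
  obtain ⟨M, hM⟩ := tail_small hL (ε / 2) (half_pos hε)
  have hM0 : (0 : ℝ) ≤ M := Nat.cast_nonneg M
  set h : Ω → ℝ := fun ω => max 0 (L ω - M) with hh
  have hhi : Integrable h P := (integrable_zero _ _ _).sup (hL.sub (integrable_const _))
  have hclm : Measurable (clip M) := by
    unfold clip; fun_prop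
  have hFm' : ∀ k, F' k ≤ m0 := fun k => (hF' k).trans (hFm k)
  have hci : ∀ k, 1 ≤ k → Integrable (c k) P := fun k hk => by
    refine ((hT.toMeasurePreserving.iterate k).integrable_comp_of_integrable hL).mono'
      (hc k hk).aestronglyMeasurable (Eventually.of_forall fun ω => hcL k ω hk)
  have hcli : ∀ k, 1 ≤ k → Integrable (fun ω => clip M (c k ω)) P := fun k hk => by
    refine Integrable.of_bound (hclm.comp (hc k hk)).aestronglyMeasurable M
      (Eventually.of_forall fun ω => clip_abs hM0 _)
  set W : ℕ → Ω → ℝ := fun k ω =>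
    (P[fun ω => clip M (c k ω) | F k]) ω - (P[fun ω => clip M (c k ω) | F' k]) ω with hW
  have hWm : ∀ k, StronglyMeasurable[F k] (W k) := fun k =>
    stronglyMeasurable_condExp.sub (stronglyMeasurable_condExp.mono (hF' k))
  have hbd : ∀ (m : MeasurableSpace Ω) k, ∀ᵐ ω ∂P, |(P[fun ω => clip M (c k ω) | m]) ω| ≤ M := by
    intro m k
    have := ae_bdd_condExp_of_ae_bdd (m := m) (μ := P) (R := (M : NNReal))
      (f := fun ω => clip M (c k ω)) (Eventually.of_forall fun ω => by simpa using clip_abs hM0 _)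
    simpa using this
  have hWb : ∀ k, ∀ᵐ ω ∂P, |W k ω| ≤ 2 * M := by
    intro k
    filter_upwards [hbd (F k) k, hbd (F' k) k] with ω h1 h2
    simp only [hW]
    rw [abs_le] at h1 h2 ⊢
    constructor <;> linarith [h1.1, h1.2, h2.1, h2.2]
  refine ⟨W, fun ω => (P[h | F 0]) ω + (P[h | F' 0]) ω, integrable_condExp.add integrable_condExp,
    ?_, ?_, ?_⟩
  · rw [integral_add integrable_condExp integrable_condExp, integral_condExp (hFm 0),
      integral_condExp (hFm' 0)]
    linarith
  · refine orth_lln W (2 * M) (fun k => ((hWm k).mono (hFm k)).aestronglyMeasurable)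
      (fun k _ => hWb k) fun i j hi hij => ?_
    have hWi : StronglyMeasurable[F' j] (W i) := (hWm i).mono (hmono i j hij)
    have hWint : ∀ k, Integrable (W k) P := fun k => integrable_condExp.sub integrable_condExp
    have hprod : Integrable (W i * W j) P := by
      refine (hWint j).bdd_mul (c := 2 * M) ((hWm i).mono (hFm i)).aestronglyMeasurable (hWb i)
    have e1 := condExp_mul_of_stronglyMeasurable_left hWi hprod (hWint j)
    have e2 : P[W j | F' j] =ᵐ[P] 0 := by
      have e3 : P[W j | F' j] =ᵐ[P] P[P[fun ω => clip M (c j ω) | F j] | F' j] -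
          P[P[fun ω => clip M (c j ω) | F' j] | F' j] :=
        condExp_sub integrable_condExp integrable_condExp _
      have e4 : P[P[fun ω => clip M (c j ω) | F j] | F' j] =ᵐ[P] P[fun ω => clip M (c j ω) | F' j] :=
        condExp_condExp_of_le (hF' j) (hFm j)
      have e5 : P[P[fun ω => clip M (c j ω) | F' j] | F' j] = P[fun ω => clip M (c j ω) | F' j] :=
        condExp_of_stronglyMeasurable (hFm' j) stronglyMeasurable_condExp integrable_condExp
      filter_upwards [e3, e4] with ω h1 h2
      rw [h1, Pi.sub_apply, h2, e5, sub_self]; rfl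
    calc ∫ ω, W i ω * W j ω ∂P = ∫ ω, (P[W i * W j | F' j]) ω ∂P := (integral_condExp (hFm' j)).symm
      _ = ∫ ω, (0 : ℝ) ∂P := by
        refine integral_congr_ae ?_
        filter_upwards [e1, e2] with ω h1 h2
        rw [h1, Pi.mul_apply, h2]; simp
      _ = 0 := by simp
  · intro k hk
    have hTk := hT.toMeasurePreserving.iterate k
    have hhk : Integrable (h ∘ T^[k]) P := hTk.integrable_comp_of_integrable hhi
    have hcl : ∀ᵐ ω ∂P, |c k ω - clip M (c k ω)| ≤ (h ∘ T^[k]) ω :=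
      Eventually.of_forall fun ω => clip_close hM0 _ _ (hcL k ω hk)
    have a1 := condExp_close (m := F k) (hci k hk) (hcli k hk) hhk hcl
    have a2 := condExp_close (m := F' k) (hci k hk) (hcli k hk) hhk hcl
    have b1 := condExp_transport hTk (hFm 0) hhi
    have b2 := condExp_transport hTk (hFm' 0) hhi
    rw [← hF0 k] at b1
    rw [← hF0' k] at b2
    filter_upwards [a1, a2, b1, b2] with ω a1 a2 b1 b2
    rw [← b1] at a1
    rw [← b2] at a2
    simp only [hW, Function.comp_apply] at a1 a2 ⊢
    rw [abs_le] at a1 a2 ⊢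
    constructor <;> linarith [a1.1, a1.2, a2.1, a2.2]

lemma iter_eq {Ω : Type*} (e : Equiv.Perm Ω) (n : ℤ) : iter e e.symm n = ⇑(e ^ n) := by
  cases n with
  | ofNat n =>
    simp only [iter, Int.ofNat_eq_natCast, zpow_natCast, Equiv.Perm.iterate_eq_pow]
  | negSucc n =>
    have h : (⇑e.symm : Ω → Ω) = ⇑(e⁻¹) := rfl
    simp only [iter, zpow_negSucc]
    rw [h, Equiv.Perm.iterate_eq_pow, inv_pow]

lemma iter_comp {Ω : Type*} {T S : Ω → Ω} (hST : Function.LeftInverse S T)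
    (hTS : Function.RightInverse S T) (a b : ℤ) : iter T S a ∘ iter T S b = iter T S (a + b) := by
  have h := iter_eq (⟨T, S, hST, hTS⟩ : Equiv.Perm Ω)
  change ∀ n, iter T S n = _ at h
  rw [h, h, h, zpow_add]
  rfl

lemma iter_nat {Ω : Type*} (T S : Ω → Ω) (n : ℕ) : iter T S (n : ℤ) = T^[n] := rfl

lemma iter_zero {Ω : Type*} (T S : Ω → Ω) : iter T S 0 = id := rfl

lemma iter_neg_nat {Ω : Type*} (T S : Ω → Ω) (n : ℕ) : iter T S (-(n : ℤ)) = S^[n] := by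
  cases n with
  | zero => rfl
  | succ n => rfl

lemma iter_mp {Ω : Type*} [m0 : MeasurableSpace Ω] {P : Measure Ω} {T S : Ω → Ω}
    (hT : MeasurePreserving T P P) (hS : MeasurePreserving S P P) (n : ℤ) :
    MeasurePreserving (iter T S n) P P := by
  cases n with
  | ofNat n => exact hT.iterate n
  | negSucc n => exact hS.iterate (n + 1)

section fields

variable {Ω : Type*} {T S : Ω → Ω}

lemma comap_iter (hST : Function.LeftInverse S T) (hTS : Function.RightInverse S T) (a b : ℤ)
    (Z : MeasurableSpace Ω) :
    MeasurableSpace.comap (iter T S a) (MeasurableSpace.comap (iter T S b) Z) =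
      MeasurableSpace.comap (iter T S (b + a)) Z := by
  rw [MeasurableSpace.comap_comp, iter_comp hST hTS]

lemma comap_obsLE_le (hST : Function.LeftInverse S T) (hTS : Function.RightInverse S T)
    (Y : MeasurableSpace Ω) (a n : ℤ) :
    MeasurableSpace.comap (iter T S a) (obsFieldLE T S Y n) ≤ obsFieldLE T S Y (n + a) := by
  unfold obsFieldLE
  simp only [MeasurableSpace.comap_iSup, comap_iter hST hTS]
  refine iSup₂_le fun k hk => ?_
  exact le_iSup₂_of_le (k + a) (by simp only [mem_Iic] at hk ⊢; omega) le_rfl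

lemma comap_obs_le (hST : Function.LeftInverse S T) (hTS : Function.RightInverse S T)
    (Y : MeasurableSpace Ω) (a m n : ℤ) :
    MeasurableSpace.comap (iter T S a) (obsField T S Y m n) ≤ obsField T S Y (m + a) (n + a) := by
  unfold obsField
  simp only [MeasurableSpace.comap_iSup, comap_iter hST hTS]
  refine iSup₂_le fun k hk => ?_
  exact le_iSup₂_of_le (k + a) (by simp only [mem_Icc] at hk ⊢; omega) le_rfl

/-- The σ-field `𝒢_k^n`. -/
def GF (T S : Ω → Ω) (Y X : MeasurableSpace Ω) (k n : ℤ) : MeasurableSpace Ω :=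
  obsFieldLE T S Y k ⊔ MeasurableSpace.comap (iter T S (k - n)) X

lemma comap_GF_le (hST : Function.LeftInverse S T) (hTS : Function.RightInverse S T)
    (Y X : MeasurableSpace Ω) (a k n : ℤ) :
    MeasurableSpace.comap (iter T S a) (GF T S Y X k n) ≤ GF T S Y X (k + a) n := by
  unfold GF
  rw [MeasurableSpace.comap_sup, comap_iter hST hTS]
  refine sup_le_sup (comap_obsLE_le hST hTS Y a k) (le_of_eq ?_)
  congr 2
  ring

lemma le_comap (hST : Function.LeftInverse S T) (hTS : Function.RightInverse S T)
    (Z Z' : MeasurableSpace Ω) (a : ℤ) (h : MeasurableSpace.comap (iter T S (-a)) Z ≤ Z') :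
    Z ≤ MeasurableSpace.comap (iter T S a) Z' := by
  have h1 := MeasurableSpace.comap_mono (g := iter T S a) h
  rw [comap_iter hST hTS] at h1
  simpa [iter_zero] using h1

lemma comap_GF (hST : Function.LeftInverse S T) (hTS : Function.RightInverse S T)
    (Y X : MeasurableSpace Ω) (a k n : ℤ) :
    MeasurableSpace.comap (iter T S a) (GF T S Y X k n) = GF T S Y X (k + a) n := by
  refine le_antisymm (comap_GF_le hST hTS Y X a k n) (le_comap hST hTS _ _ _ ?_)
  simpa using comap_GF_le hST hTS Y X (-a) (k + a) n

lemma comap_GFinf (hST : Function.LeftInverse S T) (hTS : Function.RightInverse S T)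
    (Y X : MeasurableSpace Ω) (a : ℤ) :
    MeasurableSpace.comap (iter T S a) (⨅ n : ℤ, GF T S Y X 0 n) = ⨅ n : ℤ, GF T S Y X a n := by
  refine le_antisymm (le_iInf fun n => ?_) (le_comap hST hTS _ _ _ (le_iInf fun n => ?_))
  · refine (MeasurableSpace.comap_mono (iInf_le _ n)).trans ?_
    simpa using comap_GF_le hST hTS Y X a 0 n
  · refine (MeasurableSpace.comap_mono (iInf_le _ n)).trans ?_
    simpa using comap_GF_le hST hTS Y X (-a) a n

lemma comapX_mono (hST : Function.LeftInverse S T) (hTS : Function.RightInverse S T)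
    {X : MeasurableSpace Ω} (hX1 : X ≤ MeasurableSpace.comap T X) {a b : ℤ} (hab : a ≤ b) :
    MeasurableSpace.comap (iter T S a) X ≤ MeasurableSpace.comap (iter T S b) X := by
  obtain ⟨n, rfl⟩ := Int.le.dest hab
  clear hab
  induction n with
  | zero => simp
  | succ n ih =>
    refine ih.trans ?_
    have h1 : X ≤ MeasurableSpace.comap (iter T S 1) X := hX1
    have h2 := MeasurableSpace.comap_mono (g := iter T S (a + n)) h1
    rw [comap_iter hST hTS] at h2
    refine h2.trans (le_of_eq ?_)
    congr 2
    push_cast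
    ring

lemma obsLE_mono (Y : MeasurableSpace Ω) {a b : ℤ} (hab : a ≤ b) :
    obsFieldLE T S Y a ≤ obsFieldLE T S Y b :=
  iSup₂_le fun k hk => le_iSup₂_of_le k (by simp only [mem_Iic] at hk ⊢; omega) le_rfl

lemma GF_mono (hST : Function.LeftInverse S T) (hTS : Function.RightInverse S T)
    (Y : MeasurableSpace Ω) {X : MeasurableSpace Ω} (hX1 : X ≤ MeasurableSpace.comap T X)
    {k k' n n' : ℤ} (h : k ≤ k') (h' : k - n ≤ k' - n') : GF T S Y X k n ≤ GF T S Y X k' n' :=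
  sup_le_sup (obsLE_mono Y h) (comapX_mono hST hTS hX1 h')

lemma tail_eq (hST : Function.LeftInverse S T) (hTS : Function.RightInverse S T)
    (Y : MeasurableSpace Ω) {X : MeasurableSpace Ω} (hX1 : X ≤ MeasurableSpace.comap T X) :
    tailField T S Y X = ⨅ n : ℤ, GF T S Y X 0 n := by
  have h : ∀ i : ℕ, obsFieldLE T S Y 0 ⊔ MeasurableSpace.comap (S^[i + 1]) X =
      GF T S Y X 0 ((i + 1 : ℕ) : ℤ) := by
    intro i
    unfold GF
    rw [zero_sub, iter_neg_nat]
  unfold tailField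
  simp only [h]
  refine le_antisymm (le_iInf fun n => ?_) (le_iInf fun i => iInf_le _ _)
  refine (iInf_le _ n.toNat).trans (GF_mono hST hTS Y hX1 le_rfl ?_)
  have := Int.self_le_toNat n
  push_cast
  linarith

lemma obs_le_m0 (Y : MeasurableSpace Ω) [m0 : MeasurableSpace Ω] (hT : Measurable T)
    (hS : Measurable S) (hY : Y ≤ m0) (m n : ℤ) : obsField T S Y m n ≤ m0 := by
  refine iSup₂_le fun k _ => ?_
  rintro s ⟨t, ht, rfl⟩
  cases k with
  | ofNat k => exact (hT.iterate k) (hY t ht)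
  | negSucc k => exact (hS.iterate (k + 1)) (hY t ht)

lemma GF_le_m0 (Y X : MeasurableSpace Ω) [m0 : MeasurableSpace Ω] (hT : Measurable T)
    (hS : Measurable S) (hY : Y ≤ m0) (hX : X ≤ m0) (k n : ℤ) : GF T S Y X k n ≤ m0 := by
  have aux : ∀ (Z : MeasurableSpace Ω) (j : ℤ), Z ≤ m0 →
      MeasurableSpace.comap (iter T S j) Z ≤ m0 := by
    intro Z j hZ
    rintro s ⟨t, ht, rfl⟩
    have ht' := hZ t ht
    clear ht hZ
    cases j with
    | ofNat k => exact @Measurable.iterate Ω m0 T hT k _ ht'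
    | negSucc k => exact @Measurable.iterate Ω m0 S hS (k + 1) _ ht'
  exact sup_le (iSup₂_le fun j _ => aux Y j hY) (aux X _ hX)

end fields

lemma essSup_int {Ω ι : Type*} [m0 : MeasurableSpace Ω] {P : Measure Ω} {S₀ : Set ι}
    {F : ι → Ω → ℝ} {g b : Ω → ℝ} (hg : IsEssSupFam P S₀ F g) (i : ι) (hi : i ∈ S₀)
    (h0 : ∀ ω, 0 ≤ F i ω) (hb : Integrable b P) (hF : ∀ i ∈ S₀, ∀ᵐ ω ∂P, F i ω ≤ b ω) :
    Integrable g P := by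
  have hbe := hb.1.ae_eq_mk
  have h1 := hg.2.2 (hb.1.mk b) hb.1.stronglyMeasurable_mk.measurable (fun i hi => by
    filter_upwards [hF i hi, hbe] with ω h1 h2
    rwa [← h2])
  refine hb.mono' hg.1.aestronglyMeasurable ?_
  filter_upwards [h1, hbe, hg.2.1 i hi] with ω h1 h2 h3
  rw [Real.norm_eq_abs, abs_of_nonneg ((h0 ω).trans h3), h2]
  exact h1

lemma essInf_int {Ω ι : Type*} [m0 : MeasurableSpace Ω] {P : Measure Ω} {S₀ : Set ι}
    {F : ι → Ω → ℝ} {g b : Ω → ℝ} (hg : IsEssInfFam P S₀ F g) (i : ι) (hi : i ∈ S₀)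
    (hb : Integrable b P) (hF : ∀ i ∈ S₀, ∀ᵐ ω ∂P, |F i ω| ≤ b ω) :
    Integrable g P := by
  have hbe := hb.1.ae_eq_mk
  have h1 := hg.2.2 (fun ω => - hb.1.mk b ω) hb.1.stronglyMeasurable_mk.measurable.neg
    (fun i hi => by
      filter_upwards [hF i hi, hbe] with ω h1 h2
      rw [← h2]
      exact (abs_le.1 h1).1)
  refine hb.mono' hg.1.aestronglyMeasurable ?_
  filter_upwards [h1, hbe, hg.2.1 i hi, hF i hi] with ω h1 h2 h3 h4
  rw [← h2] at h1
  rw [Real.norm_eq_abs, abs_le]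
  exact ⟨h1, h3.trans (abs_le.1 h4).2⟩

lemma condExp_abs_bd {Ω : Type*} {m : MeasurableSpace Ω} [m0 : MeasurableSpace Ω] {P : Measure Ω}
    {a g : Ω → ℝ} (ha : Integrable a P) (hg : Integrable g P)
    (h : ∀ ω, |a ω| ≤ g ω) : ∀ᵐ ω ∂P, |(P[a | m]) ω| ≤ (P[g | m]) ω := by
  have := condExp_close (m := m) ha (integrable_zero Ω ℝ P) hg
    (Eventually.of_forall fun ω => by simpa using h ω)
  filter_upwards [this] with ω hω
  simpa [condExp_zero] using hω

lemma main_aux {Ω U : Type*} (Y X : MeasurableSpace Ω) [m0 : MeasurableSpace Ω]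
    [MeasurableSpace U] [Nonempty U]
    (P : Measure Ω) [IsProbabilityMeasure P]
    (T S : Ω → Ω) (hT : Ergodic T P) (hS : MeasurePreserving S P P)
    (hST : Function.LeftInverse S T) (hTS : Function.RightInverse S T)
    (ℓ : U → Ω → ℝ) (hℓ : Measurable fun p : U × Ω => ℓ p.1 p.2)
    (Λ : Ω → ℝ) (hΛ : Integrable Λ P) (hdom : ∀ u ω, |ℓ u ω| ≤ Λ ω)
    (hY : Y ≤ m0)
    (hX : X ≤ m0) (hX1 : X ≤ MeasurableSpace.comap T X)
    (g₁ : ℕ → Ω → ℝ)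
    (hg₁ : ∀ n : ℕ, IsEssSupFam P (Un T S Y 0 : Set (Ω → U))
      (fun v ω =>
        |(P[lossAt T S ℓ 0 v | obsFieldLE T S Y 0 ⊔ MeasurableSpace.comap (T^[n]) X]) ω -
          lossAt T S ℓ 0 v ω|) (g₁ n))
    (hg₁0 : Tendsto (fun n : ℕ => ∫ ω, |g₁ n ω| ∂P) atTop (𝓝 0))
    (g₂ : ℕ → Ω → ℝ)
    (hg₂ : ∀ n : ℕ, IsEssSupFam P (Un T S Y 0 : Set (Ω → U))
      (fun v ω =>
        |(P[lossAt T S ℓ 0 v | obsFieldLE T S Y 0 ⊔ MeasurableSpace.comap (S^[n]) X]) ω -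
          (P[lossAt T S ℓ 0 v | tailField T S Y X]) ω|) (g₂ n))
    (hg₂0 : Tendsto (fun n : ℕ => ∫ ω, |g₂ n ω| ∂P) atTop (𝓝 0))
    (ginf₁ ginf₂ : Ω → ℝ)
    (hinf₂ : IsEssInfFam P (Un T S Y 0 : Set (Ω → U))
      (fun v => P[lossAt T S ℓ 0 v | tailField T S Y X]) ginf₂)
    (hL : ∫ ω, ginf₁ ω ∂P = ∫ ω, ginf₂ ω ∂P) (u : ℕ → Ω → U) (hu : Admissible T S Y u) :
      (∀ᵐ ω ∂P, Tendsto
        (fun N : ℕ => (N : ℝ)⁻¹ * ∑ k ∈ Finset.Icc 1 N,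
          (lossAt T S ℓ (k : ℤ) (u k) ω -
            (P[lossAt T S ℓ (k : ℤ) (u k) |
              ⨅ n : ℤ, obsFieldLE T S Y (k : ℤ) ⊔
                MeasurableSpace.comap (iter T S ((k : ℤ) - n)) X]) ω))
        atTop (𝓝 0)) ∧
      ∀ᵐ ω ∂P, (∫ ω', ginf₁ ω' ∂P) ≤
        Filter.liminf (fun N : ℕ => avgLoss T S ℓ u N ω) atTop := by
  have hTm := hT.measurable
  have hSm := hS.measurable
  have hmp := iter_mp hT.toMeasurePreserving hS
  -- rewrite the σ-fields
  have et : ∀ n : ℕ, obsFieldLE T S Y 0 ⊔ MeasurableSpace.comap (T^[n]) X =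
      GF T S Y X 0 (-(n : ℤ)) := by
    intro n; unfold GF; rw [zero_sub, neg_neg, iter_nat]
  have es : ∀ n : ℕ, obsFieldLE T S Y 0 ⊔ MeasurableSpace.comap (S^[n]) X =
      GF T S Y X 0 (n : ℤ) := by
    intro n; unfold GF; rw [zero_sub, iter_neg_nat]
  have etail := tail_eq hST hTS Y hX1
  simp only [et] at hg₁
  simp only [es, etail] at hg₂
  simp only [etail] at hinf₂
  set GI : ℤ → MeasurableSpace Ω := fun k => ⨅ n : ℤ, GF T S Y X k n with hGI
  have hGm : ∀ k n, GF T S Y X k n ≤ m0 := GF_le_m0 Y X hTm hSm hY hX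
  have hGIm : ∀ k, GI k ≤ m0 := fun k => (iInf_le _ 0).trans (hGm k 0)
  -- losses
  have hlm : ∀ (k : ℤ) (v : Ω → U), Measurable v → Measurable (lossAt T S ℓ k v) :=
    fun k v hv => hℓ.comp (hv.prodMk (hmp k).measurable)
  have hli0 : ∀ v : Ω → U, Measurable v → Integrable (lossAt T S ℓ 0 v) P := fun v hv =>
    hΛ.mono' (hlm 0 v hv).aestronglyMeasurable (Eventually.of_forall fun ω => hdom _ _)
  have hUn : ∀ v ∈ (Un T S Y 0 : Set (Ω → U)), Measurable v := by
    intro v hv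
    simp only [Un, mem_iUnion] at hv
    obtain ⟨m, _, hv⟩ := hv
    exact Measurable.mono hv (obs_le_m0 Y hTm hSm hY m 0) le_rfl
  have hum : ∀ k, 1 ≤ k → Measurable (u k) := fun k hk =>
    Measurable.mono (hu k hk) (obs_le_m0 Y hTm hSm hY 0 k) le_rfl
  obtain ⟨u0⟩ := ‹Nonempty U›
  have hconst : (fun _ : Ω => u0) ∈ (Un T S Y 0 : Set (Ω → U)) := by
    simp only [Un, mem_iUnion]
    exact ⟨0, by simp, @measurable_const _ _ _ (_) _⟩
  -- shifted decision
  set v : ℕ → Ω → U := fun k => u k ∘ iter T S (-(k : ℤ)) with hv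
  have hvU : ∀ k, 1 ≤ k → v k ∈ (Un T S Y 0 : Set (Ω → U)) := by
    intro k hk
    simp only [Un, mem_iUnion]
    refine ⟨-(k : ℤ), by simp, ?_⟩
    have h1 : Measurable[MeasurableSpace.comap (iter T S (-(k : ℤ))) (obsField T S Y 0 k)] (v k) :=
      @Measurable.comp _ _ _ (_) (_) (_) _ _ (hu k hk) (comap_measurable _)
    refine Measurable.mono h1 ?_ le_rfl
    have := comap_obs_le hST hTS Y (-(k : ℤ)) 0 k
    simpa using this
  have hloss : ∀ k : ℕ, lossAt T S ℓ (k : ℤ) (u k) = lossAt T S ℓ 0 (v k) ∘ T^[k] := by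
    intro k
    funext ω
    have h1 : iter T S (-(k : ℤ)) (T^[k] ω) = ω := by
      have := congrFun (iter_comp hST hTS (-(k : ℤ)) k) ω
      simpa [iter_zero, iter_nat] using this
    simp only [lossAt, hv, Function.comp_apply, h1, iter_zero, id, iter_nat]
  set c : ℕ → Ω → ℝ := fun k => lossAt T S ℓ (k : ℤ) (u k) with hc
  have hcm : ∀ k, 1 ≤ k → Measurable (c k) := fun k hk => hlm _ _ (hum k hk)
  have hcL : ∀ k ω, 1 ≤ k → |c k ω| ≤ Λ (T^[k] ω) := fun k ω _ => hdom _ _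
  have hTk := fun k => hT.toMeasurePreserving.iterate k
  have hGk : ∀ (k : ℕ) (n : ℤ), GF T S Y X k n = MeasurableSpace.comap (T^[k]) (GF T S Y X 0 n) := by
    intro k n
    rw [← iter_nat T S, comap_GF hST hTS, zero_add]
  have hGIk : ∀ k : ℕ, GI k = MeasurableSpace.comap (T^[k]) (GI 0) := by
    intro k
    rw [← iter_nat T S, hGI, comap_GFinf hST hTS]
  have tr : ∀ (k : ℕ) (n : ℤ), 1 ≤ k →
      (P[lossAt T S ℓ 0 (v k) | GF T S Y X 0 n]) ∘ T^[k] =ᵐ[P] P[c k | GF T S Y X k n] := by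
    intro k n hk
    rw [hGk, hc]
    simp only [hloss k]
    exact condExp_transport (hTk k) (hGm 0 n) (hli0 _ (hUn _ (hvU k hk)))
  have trI : ∀ (k : ℕ), 1 ≤ k →
      (P[lossAt T S ℓ 0 (v k) | GI 0]) ∘ T^[k] =ᵐ[P] P[c k | GI k] := by
    intro k hk
    rw [hGIk, hc]
    simp only [hloss k]
    exact condExp_transport (hTk k) (hGIm 0) (hli0 _ (hUn _ (hvU k hk)))
  -- middle terms
  have hstep : ∀ j : ℤ, ∀ᵐ ω ∂P, Tendsto (av (fun k : ℕ =>
      (P[c k | GF T S Y X k j]) ω - (P[c k | GF T S Y X k (j + 1)]) ω)) atTop (𝓝 0) := by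
    intro j
    refine step (fun k : ℕ => GF T S Y X k j) (fun k : ℕ => GF T S Y X k (j + 1)) hT
      (fun k => hGm _ _) (fun k => GF_mono hST hTS Y hX1 le_rfl (by omega))
      (fun i k hik => GF_mono hST hTS Y hX1 (by omega) (by omega)) (fun k => hGk k j)
      (fun k => hGk k (j + 1)) c hcm Λ hΛ hcL
  have hmid : ∀ (j : ℤ) (n : ℕ), ∀ᵐ ω ∂P, Tendsto (av (fun k : ℕ =>
      (P[c k | GF T S Y X k j]) ω - (P[c k | GF T S Y X k (j + n)]) ω)) atTop (𝓝 0) := by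
    intro j n
    induction n with
    | zero =>
      refine Eventually.of_forall fun ω => ?_
      have : av (fun k : ℕ => (P[c k | GF T S Y X k j]) ω -
          (P[c k | GF T S Y X k (j + (0 : ℕ))]) ω) = fun _ => 0 := by
        funext N; simp [av]
      rw [this]
      exact tendsto_const_nhds
    | succ n ih =>
      filter_upwards [ih, hstep (j + n)] with ω h1 h2
      have h3 := h1.add h2
      rw [add_zero] at h3
      refine h3.congr fun N => ?_
      rw [← av_add]
      congr 1
      funext k
      have : j + ((n + 1 : ℕ) : ℤ) = j + n + 1 := by push_cast; ring
      rw [this]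
      ring
  -- integrability of the essential suprema
  have hi₁ : ∀ n, Integrable (g₁ n) P := by
    intro n
    refine essSup_int (hg₁ n) _ hconst (fun ω => abs_nonneg _)
      (b := fun ω => (P[Λ | GF T S Y X 0 (-(n : ℤ))]) ω + Λ ω) (integrable_condExp.add hΛ) ?_
    intro w hw
    filter_upwards [condExp_abs_bd (m := GF T S Y X 0 (-(n : ℤ))) (hli0 w (hUn w hw)) hΛ
      (fun ω => hdom _ _)] with ω hω
    exact (abs_sub _ _).trans (add_le_add hω (hdom _ _))
  have hi₂ : ∀ n, Integrable (g₂ n) P := by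
    intro n
    refine essSup_int (hg₂ n) _ hconst (fun ω => abs_nonneg _)
      (b := fun ω => (P[Λ | GF T S Y X 0 (n : ℤ)]) ω + (P[Λ | GI 0]) ω)
      (integrable_condExp.add integrable_condExp) ?_
    intro w hw
    filter_upwards [condExp_abs_bd (m := GF T S Y X 0 (n : ℤ)) (hli0 w (hUn w hw)) hΛ
      (fun ω => hdom _ _), condExp_abs_bd (m := GI 0) (hli0 w (hUn w hw)) hΛ
      (fun ω => hdom _ _)] with ω hω hω'
    exact (abs_sub _ _).trans (add_le_add hω hω')
  have hiinf : Integrable ginf₂ P := by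
    refine essInf_int hinf₂ _ hconst (b := P[Λ | GI 0]) integrable_condExp ?_
    intro w hw
    exact condExp_abs_bd (m := GI 0) (hli0 w (hUn w hw)) hΛ (fun ω => hdom _ _)
  -- first claim
  have claim : ∀ᵐ ω ∂P, Tendsto (av (fun k : ℕ => c k ω - (P[c k | GI k]) ω)) atTop (𝓝 0) := by
    refine approx hT (fun (k : ℕ) ω => c k ω - (P[c k | GI k]) ω) fun ε hε => ?_
    have hlim := hg₁0.add hg₂0
    rw [add_zero] at hlim
    obtain ⟨m, hm⟩ := (hlim.eventually (eventually_lt_nhds hε)).exists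
    refine ⟨fun k ω => (P[c k | GF T S Y X k (-(m : ℤ))]) ω - (P[c k | GF T S Y X k (m : ℤ)]) ω,
      fun ω => |g₁ m ω| + |g₂ m ω|, (hi₁ m).abs.add (hi₂ m).abs, ?_, ?_, ?_⟩
    · rw [integral_add (hi₁ m).abs (hi₂ m).abs]
      exact hm
    · have := hmid (-(m : ℤ)) (2 * m)
      have e : -(m : ℤ) + ((2 * m : ℕ) : ℤ) = m := by push_cast; ring
      rw [e] at this
      exact this
    · intro k hk
      have a1 := (hTk k).quasiMeasurePreserving.ae ((hg₁ m).2.1 (v k) (hvU k hk))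
      have a2 := (hTk k).quasiMeasurePreserving.ae ((hg₂ m).2.1 (v k) (hvU k hk))
      filter_upwards [a1, a2, tr k (-(m : ℤ)) hk, tr k m hk, trI k hk] with ω a1 a2 b1 b2 b3
      simp only [Function.comp_apply] at b1 b2 b3
      have b4 : lossAt T S ℓ 0 (v k) (T^[k] ω) = c k ω := (congrFun (hloss k) ω).symm
      rw [b1, b4] at a1
      have a2' : |(P[c k | GF T S Y X k (m : ℤ)]) ω - (P[c k | GI k]) ω| ≤ g₂ m (T^[k] ω) := by
        rw [← b2, ← b3]; exact a2
      have a3 := a1.trans (le_abs_self _)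
      have a4 := a2'.trans (le_abs_self _)
      rw [abs_le] at a3 a4 ⊢
      constructor <;> linarith [a3.1, a3.2, a4.1, a4.2]
  refine ⟨claim, ?_⟩
  rw [hL]
  have hlow : ∀ᵐ ω ∂P, ∀ k : ℕ, 1 ≤ k → ginf₂ (T^[k] ω) ≤ (P[c k | GI k]) ω := by
    refine ae_all_iff.2 fun k => ?_
    by_cases hk : 1 ≤ k
    · have a1 := (hTk k).quasiMeasurePreserving.ae (hinf₂.2.1 (v k) (hvU k hk))
      filter_upwards [a1, trI k hk] with ω a1 b _
      rw [← b]
      exact a1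
    · exact Eventually.of_forall fun ω h => absurd h hk
  filter_upwards [claim, hlow, birkhoff hT hiinf, birkhoff hT hΛ] with ω h1 h2 h3 h4
  have h5 := h1.add h3
  rw [zero_add] at h5
  have hle : ∀ N, av (fun k : ℕ => c k ω - (P[c k | GI k]) ω) N + av (fun k => ginf₂ (T^[k] ω)) N ≤
      avgLoss T S ℓ u N ω := by
    intro N
    rw [← av_add]
    change _ ≤ av (fun k => c k ω) N
    refine av_mono' (fun k hk => ?_) N
    have := h2 k hk
    linarith
  have hup : ∀ N, avgLoss T S ℓ u N ω ≤ av (fun k => Λ (T^[k] ω)) N := by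
    intro N
    change av (fun k => c k ω) N ≤ _
    exact av_mono' (fun k hk => (le_abs_self _).trans (hcL k ω hk)) N
  rw [← h5.liminf_eq]
  refine liminf_le_liminf (Eventually.of_forall hle) h5.isBoundedUnder_ge ?_
  exact (h4.isBoundedUnder_le.mono_le (Eventually.of_forall hup)).isCoboundedUnder_ge

/-- Corollary 4.2: under the assumptions of Theorem 2.6, for every
admissible strategy `u` the Cesàro averages of `ℓ_k(u_k) − E[ℓ_k(u_k)|𝒢ₖ^∞]` converge to `0`
a.s., and consequently `liminf_T L_T(u) ≥ L⋆` a.s. -/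
theorem statement15
    {Ω U : Type*} [m0 : MeasurableSpace Ω] [MeasurableSpace U] [Nonempty U]
    (P : Measure Ω) [IsProbabilityMeasure P]
    (T S : Ω → Ω) (hT : Ergodic T P) (hS : MeasurePreserving S P P)
    (hST : Function.LeftInverse S T) (hTS : Function.RightInverse S T)
    (ℓ : U → Ω → ℝ) (hℓ : Measurable fun p : U × Ω => ℓ p.1 p.2)
    (Λ : Ω → ℝ) (hΛ : Integrable Λ P) (hdom : ∀ u ω, |ℓ u ω| ≤ Λ ω)
    (Y : MeasurableSpace Ω) (hY : Y ≤ m0)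
    (X : MeasurableSpace Ω) (hX : X ≤ m0) (hX1 : X ≤ MeasurableSpace.comap T X)
    (g₁ : ℕ → Ω → ℝ)
    (hg₁ : ∀ n : ℕ, IsEssSupFam P (Un T S Y 0 : Set (Ω → U))
      (fun v ω =>
        |(P[lossAt T S ℓ 0 v | obsFieldLE T S Y 0 ⊔ MeasurableSpace.comap (T^[n]) X]) ω -
          lossAt T S ℓ 0 v ω|) (g₁ n))
    (hg₁0 : Tendsto (fun n : ℕ => ∫ ω, |g₁ n ω| ∂P) atTop (𝓝 0))
    (g₂ : ℕ → Ω → ℝ)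
    (hg₂ : ∀ n : ℕ, IsEssSupFam P (Un T S Y 0 : Set (Ω → U))
      (fun v ω =>
        |(P[lossAt T S ℓ 0 v | obsFieldLE T S Y 0 ⊔ MeasurableSpace.comap (S^[n]) X]) ω -
          (P[lossAt T S ℓ 0 v | tailField T S Y X]) ω|) (g₂ n))
    (hg₂0 : Tendsto (fun n : ℕ => ∫ ω, |g₂ n ω| ∂P) atTop (𝓝 0))
    (ginf₁ ginf₂ : Ω → ℝ)
    (hinf₁ : IsEssInfFam P (Un T S Y 0 : Set (Ω → U))
      (fun v => P[lossAt T S ℓ 0 v | obsFieldLE T S Y 0]) ginf₁)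
    (hinf₂ : IsEssInfFam P (Un T S Y 0 : Set (Ω → U))
      (fun v => P[lossAt T S ℓ 0 v | tailField T S Y X]) ginf₂)
    (hL : ∫ ω, ginf₁ ω ∂P = ∫ ω, ginf₂ ω ∂P) :
    ∀ u : ℕ → Ω → U, Admissible T S Y u →
      (∀ᵐ ω ∂P, Tendsto
        (fun N : ℕ => (N : ℝ)⁻¹ * ∑ k ∈ Finset.Icc 1 N,
          (lossAt T S ℓ (k : ℤ) (u k) ω -
            (P[lossAt T S ℓ (k : ℤ) (u k) |
              ⨅ n : ℤ, obsFieldLE T S Y (k : ℤ) ⊔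
                MeasurableSpace.comap (iter T S ((k : ℤ) - n)) X]) ω))
        atTop (𝓝 0)) ∧
      ∀ᵐ ω ∂P, (∫ ω', ginf₁ ω' ∂P) ≤
        Filter.liminf (fun N : ℕ => avgLoss T S ℓ u N ω) atTop := by
  intro u hu
  exact @main_aux Ω U Y X m0 _ _ P _ T S hT hS hST hTS ℓ hℓ Λ hΛ hdom hY hX hX1 g₁ hg₁ hg₁0 g₂ hg₂ hg₂0
    ginf₁ ginf₂ hinf₂ hL u hu

end ErgodicDecisions
end
end

section
/- Suppose the uniform conditional mixing assumption holds: lim_{M→∞} limsup_{T→∞} E[(1/T) Σ_{k=1}^{T} ess sup_{u,u' ∈ 𝕌_0} |E[(ℓ̄_0^M(u) ∘ T^{−k}) · ℓ̄_0^M(u') | 𝒴_{−∞,0}]|] = 0. Then for every admissible strategy u: (1/T) Σ_{k=1}^{T} (ℓ_k(u_k) − E[ℓ_k(u_k) | 𝒴_{−∞,k}]) → 0 in L¹(P) as T → ∞. -/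
open MeasureTheory Filter Set
open scoped ENNReal Topology symmDiff

noncomputable section

namespace ErgodicDecisions

variable {Ω U : Type*}

variable {m0 : MeasurableSpace Ω} [mU : MeasurableSpace U]

/-- Second moment bound for a bounded sequence with summably small correlations. -/
theorem second_moment_bound {α : Type*} [MeasurableSpace α] (μ : Measure α)
    [IsProbabilityMeasure μ] (X : ℕ → α → ℝ) (C : ℝ) (g : ℕ → ℝ)
    (hX : ∀ k, 1 ≤ k → AEStronglyMeasurable (X k) μ)
    (hC : ∀ k, 1 ≤ k → ∀ᵐ ω ∂μ, |X k ω| ≤ C)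
    (hg : ∀ r, 1 ≤ r → 0 ≤ g r)
    (hcov : ∀ j r, 1 ≤ j → 1 ≤ r → ∫ ω, X j ω * X (j + r) ω ∂μ ≤ g r)
    (n : ℕ) :
    (∫ ω, |(n : ℝ)⁻¹ * ∑ k ∈ Finset.Icc 1 n, X k ω| ∂μ) ^ 2 ≤
      (n : ℝ)⁻¹ * C ^ 2 + 2 * ((n : ℝ)⁻¹ * ∑ r ∈ Finset.Icc 1 n, g r) := by
  rcases Nat.eq_zero_or_pos n with rfl | hn
  · simp
  have hmem : ∀ k, 1 ≤ k → MemLp (X k) 2 μ := fun k hk =>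
    MemLp.of_bound (hX k hk) C (hC k hk)
  have hprodI : ∀ j k, 1 ≤ j → 1 ≤ k → Integrable (fun ω => X j ω * X k ω) μ := fun j k hj hk =>
    (hmem j hj).integrable_mul (hmem k hk)
  have hA : MemLp (fun ω => (n : ℝ)⁻¹ * ∑ k ∈ Finset.Icc 1 n, X k ω) 2 μ := by
    apply MemLp.const_mul
    apply memLp_finsetSum
    intro k hk
    exact hmem k (Finset.mem_Icc.1 hk).1
  have h1 : (∫ ω, |(n : ℝ)⁻¹ * ∑ k ∈ Finset.Icc 1 n, X k ω| ∂μ) ^ 2 ≤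
      ∫ ω, ((n : ℝ)⁻¹ * ∑ k ∈ Finset.Icc 1 n, X k ω) ^ 2 ∂μ := by
    have hv := ProbabilityTheory.variance_eq_sub hA.abs
    have h0 := ProbabilityTheory.variance_nonneg
      (|fun ω => (n : ℝ)⁻¹ * ∑ k ∈ Finset.Icc 1 n, X k ω|) μ
    rw [hv] at h0
    simp only [Pi.pow_apply, Pi.abs_apply, sq_abs] at h0
    linarith
  refine h1.trans ?_
  have h2 : ∫ ω, ((n : ℝ)⁻¹ * ∑ k ∈ Finset.Icc 1 n, X k ω) ^ 2 ∂μ =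
      ((n : ℝ)⁻¹) ^ 2 * ∑ j ∈ Finset.Icc 1 n, ∑ k ∈ Finset.Icc 1 n, ∫ ω, X j ω * X k ω ∂μ := by
    simp_rw [mul_pow, pow_two (∑ k ∈ Finset.Icc 1 n, X k _), Finset.sum_mul_sum]
    rw [integral_const_mul, integral_finsetSum]
    · congr 1
      refine Finset.sum_congr rfl fun j hj => ?_
      rw [integral_finsetSum]
      intro k hk
      exact hprodI j k (Finset.mem_Icc.1 hj).1 (Finset.mem_Icc.1 hk).1
    · intro j hj
      apply integrable_finsetSum
      intro k hk
      exact hprodI j k (Finset.mem_Icc.1 hj).1 (Finset.mem_Icc.1 hk).1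
  rw [h2]
  have h3 : ∀ j ∈ Finset.Icc 1 n, ∀ k ∈ Finset.Icc 1 n, ∫ ω, X j ω * X k ω ∂μ ≤
      (if j = k then C ^ 2 else 0) + ((∑ r ∈ Finset.Icc 1 n, if k = j + r then g r else 0) +
        (∑ r ∈ Finset.Icc 1 n, if j = k + r then g r else 0)) := by
    intro j hj k hk
    rw [Finset.mem_Icc] at hj hk
    have hs : ∀ a b : ℕ, 0 ≤ ∑ r ∈ Finset.Icc 1 n, if a = b + r then g r else 0 := by
      intro a b
      refine Finset.sum_nonneg fun r hr => ?_
      split_ifs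
      · exact hg r (Finset.mem_Icc.1 hr).1
      · exact le_rfl
    have hs' : ∀ a b : ℕ, 1 ≤ b → b < a → a ≤ n →
        g (a - b) ≤ ∑ r ∈ Finset.Icc 1 n, if a = b + r then g r else 0 := by
      intro a b h1b hb ha
      refine le_trans ?_ (Finset.single_le_sum (f := fun r => if a = b + r then g r else 0)
        ?_ (Finset.mem_Icc.2 (⟨?_, ?_⟩ : 1 ≤ a - b ∧ a - b ≤ n)))
      · rw [if_pos (by omega)]
      · intro r hr
        split_ifs
        · exact hg r (Finset.mem_Icc.1 hr).1
        · exact le_rfl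
      · omega
      · omega
    rcases lt_trichotomy j k with h | h | h
    · have := hcov j (k - j) hj.1 (by omega)
      rw [show j + (k - j) = k by omega] at this
      have h4 := hs' k j hj.1 h hk.2
      have h5 := hs j k
      rw [if_neg h.ne]
      linarith
    · subst h
      have h4 := hs j j
      rw [if_pos rfl]
      have : ∫ ω, X j ω * X j ω ∂μ ≤ ∫ _, C ^ 2 ∂μ := by
        refine integral_mono_ae (hprodI j j hj.1 hj.1) (integrable_const _) ?_
        filter_upwards [hC j hj.1] with ω hω
        have := sq_le_sq' (by linarith [abs_nonneg (X j ω)]) hω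
        rw [sq_abs] at this
        simpa [pow_two] using this
      simp at this
      linarith
    · have := hcov k (j - k) hk.1 (by omega)
      rw [show k + (j - k) = j by omega] at this
      have h4 := hs' j k hk.1 h hj.2
      have h5 := hs k j
      rw [if_neg h.ne']
      simp_rw [mul_comm (X j _)]
      linarith
  have h4 : ∀ j : ℕ, ∑ k ∈ Finset.Icc 1 n, (∑ r ∈ Finset.Icc 1 n, if k = j + r then g r else 0) ≤
      ∑ r ∈ Finset.Icc 1 n, g r := by
    intro j
    rw [Finset.sum_comm]
    refine Finset.sum_le_sum fun r hr => ?_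
    rw [Finset.sum_ite_eq']
    split_ifs
    · exact le_rfl
    · exact hg r (Finset.mem_Icc.1 hr).1
  have h5 : ∑ j ∈ Finset.Icc 1 n, ∑ k ∈ Finset.Icc 1 n, ∫ ω, X j ω * X k ω ∂μ ≤
      n * C ^ 2 + 2 * (n * ∑ r ∈ Finset.Icc 1 n, g r) := by
    refine (Finset.sum_le_sum fun j hj => Finset.sum_le_sum fun k hk => h3 j hj k hk).trans ?_
    simp_rw [Finset.sum_add_distrib]
    have a1 : ∑ j ∈ Finset.Icc 1 n, ∑ k ∈ Finset.Icc 1 n, (if j = k then C ^ 2 else 0) =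
        n * C ^ 2 := by
      rw [Finset.sum_congr rfl (g := fun _ => C ^ 2)]
      · simp
      · intro j hj
        rw [Finset.sum_ite_eq, if_pos hj]
    have a2 : ∑ j ∈ Finset.Icc 1 n, ∑ k ∈ Finset.Icc 1 n,
        (∑ r ∈ Finset.Icc 1 n, if k = j + r then g r else 0) ≤
        n * ∑ r ∈ Finset.Icc 1 n, g r := by
      refine (Finset.sum_le_sum fun j _ => h4 j).trans ?_
      simp
    have a3 : ∑ j ∈ Finset.Icc 1 n, ∑ k ∈ Finset.Icc 1 n,
        (∑ r ∈ Finset.Icc 1 n, if j = k + r then g r else 0) ≤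
        n * ∑ r ∈ Finset.Icc 1 n, g r := by
      rw [Finset.sum_comm]
      exact a2
    linarith
  have hn' : (0 : ℝ) < n := by exact_mod_cast hn
  calc ((n : ℝ)⁻¹) ^ 2 * ∑ j ∈ Finset.Icc 1 n, ∑ k ∈ Finset.Icc 1 n, ∫ ω, X j ω * X k ω ∂μ
      ≤ ((n : ℝ)⁻¹) ^ 2 * (n * C ^ 2 + 2 * (n * ∑ r ∈ Finset.Icc 1 n, g r)) := by gcongr
    _ = _ := by field_simp

/-- Conditional expectations commute with measure preserving embeddings. -/
theorem condExp_comp_of_measurePreserving {α : Type*} (m : MeasurableSpace α)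
    [mα : MeasurableSpace α] (μ : Measure α) [IsProbabilityMeasure μ] (φ : α → α) (hφ : MeasurePreserving φ μ μ)
    (hφe : MeasurableEmbedding φ) (hm : m ≤ mα)
    (f : α → ℝ) (hf : Integrable f μ) :
    (fun ω => (μ[f | m]) (φ ω)) =ᵐ[μ] μ[(fun ω => f (φ ω)) | MeasurableSpace.comap φ m] := by
  have hm' : MeasurableSpace.comap φ m ≤ mα :=
    (MeasurableSpace.comap_mono hm).trans hφ.measurable.comap_le
  refine ae_eq_condExp_of_forall_setIntegral_eq hm' ?_ ?_ ?_ ?_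
  · exact hφ.integrable_comp_of_integrable hf
  · intro s _ _
    exact (hφ.integrable_comp_of_integrable integrable_condExp).integrableOn
  · rintro s ⟨A, hA, rfl⟩ _
    rw [hφ.setIntegral_preimage_emb hφe (fun ω => (μ[f | m]) ω),
      hφ.setIntegral_preimage_emb hφe f]
    exact setIntegral_condExp hm hf hA
  · refine StronglyMeasurable.aestronglyMeasurable ?_
    exact (stronglyMeasurable_condExp (m := m)).comp_measurable (comap_measurable φ)

theorem iter_eq_zpow {α : Type*} (e : Equiv.Perm α) (n : ℤ) :
    iter (e : α → α) (e.symm : α → α) n = ((e ^ n : Equiv.Perm α) : α → α) := by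
  cases n with
  | ofNat n =>
    simp only [iter, Int.ofNat_eq_natCast, zpow_natCast]
    exact Equiv.Perm.iterate_eq_pow e n
  | negSucc n =>
    simp only [iter, zpow_negSucc]
    rw [← inv_pow]
    exact Equiv.Perm.iterate_eq_pow e⁻¹ (n + 1)

theorem iter_add_apply {α : Type*} {T S : α → α} (hST : Function.LeftInverse S T)
    (hTS : Function.RightInverse S T) (a b : ℤ) (x : α) :
    iter T S a (iter T S b x) = iter T S (a + b) x := by
  have h := iter_eq_zpow (⟨T, S, hST, hTS⟩ : Equiv.Perm α)
  change ∀ n, iter T S n = _ at h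
  rw [h, h, h, zpow_add]
  rfl

theorem iter_natCast {α : Type*} (T S : α → α) (n : ℕ) : iter T S (n : ℤ) = T^[n] := rfl

theorem iter_neg_natCast {α : Type*} (T S : α → α) (n : ℕ) : iter T S (-(n : ℤ)) = S^[n] := by
  cases n with
  | zero => rfl
  | succ n => rfl

theorem comap_obsFieldLE {α : Type*} {T S : α → α} (hST : Function.LeftInverse S T)
    (hTS : Function.RightInverse S T) (Y : MeasurableSpace α) (n : ℕ) :
    MeasurableSpace.comap (T^[n]) (obsFieldLE T S Y 0) = obsFieldLE T S Y (n : ℤ) := by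
  have key : ∀ k : ℤ, MeasurableSpace.comap (T^[n]) (MeasurableSpace.comap (iter T S k) Y) =
      MeasurableSpace.comap (iter T S (k + n)) Y := by
    intro k
    rw [MeasurableSpace.comap_comp]
    congr 1
    funext x
    rw [Function.comp_apply, ← iter_natCast T S n, iter_add_apply hST hTS]
  unfold obsFieldLE
  simp_rw [MeasurableSpace.comap_iSup, key]
  apply le_antisymm
  · refine iSup₂_le fun k hk => ?_
    exact le_iSup₂_of_le (k + n) (by simpa using hk) le_rfl
  · refine iSup₂_le fun k hk => ?_
    refine le_iSup₂_of_le (k - n) (by simpa using hk) ?_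
    rw [sub_add_cancel]

theorem comap_obsField_le {α : Type*} {T S : α → α} (hST : Function.LeftInverse S T)
    (hTS : Function.RightInverse S T) (Y : MeasurableSpace α) (n : ℕ) :
    MeasurableSpace.comap (S^[n]) (obsField T S Y 0 n) ≤ obsField T S Y (-n) 0 := by
  unfold obsField
  simp_rw [MeasurableSpace.comap_iSup]
  refine iSup₂_le fun k hk => ?_
  refine le_iSup₂_of_le (k - n) ?_ ?_
  · simp only [Set.mem_Icc] at hk ⊢
    omega
  · rw [MeasurableSpace.comap_comp]
    apply le_of_eq
    congr 1
    funext x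
    rw [Function.comp_apply, ← iter_neg_natCast T S n, iter_add_apply hST hTS, sub_eq_add_neg]

theorem measurable_iter {α : Type*} [MeasurableSpace α] {T S : α → α} (hT : Measurable T)
    (hS : Measurable S) (k : ℤ) : Measurable (iter T S k) := by
  cases k with
  | ofNat n => exact hT.iterate n
  | negSucc n => exact hS.iterate (n + 1)

theorem obsFieldLE_le {α : Type*} (Y : MeasurableSpace α) [mα : MeasurableSpace α] {T S : α → α}
    (hT : Measurable T) (hS : Measurable S) (hY : Y ≤ mα) (n : ℤ) :
    obsFieldLE T S Y n ≤ mα :=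
  iSup₂_le fun k _ => (MeasurableSpace.comap_mono hY).trans (measurable_iter hT hS k).comap_le

theorem obsField_le {α : Type*} (Y : MeasurableSpace α) [mα : MeasurableSpace α] {T S : α → α}
    (hT : Measurable T) (hS : Measurable S) (hY : Y ≤ mα) (m n : ℤ) :
    obsField T S Y m n ≤ mα :=
  iSup₂_le fun k _ => (MeasurableSpace.comap_mono hY).trans (measurable_iter hT hS k).comap_le

section Main

variable {Ω U : Type*} (Y : MeasurableSpace Ω) [m0 : MeasurableSpace Ω] [MeasurableSpace U]
    (P : Measure Ω) [IsProbabilityMeasure P]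

theorem truncLoss_aesm (ℓ : U → Ω → ℝ) (hℓ : Measurable fun p : U × Ω => ℓ p.1 p.2)
    (Λ : Ω → ℝ) (hΛ : Integrable Λ P) (M : ℝ) (v : Ω → U) (hv : Measurable v) :
    AEStronglyMeasurable (truncLoss ℓ Λ M v) P := by
  have h1 : Measurable fun ω => ℓ (v ω) ω := hℓ.comp (hv.prodMk measurable_id)
  obtain ⟨Λ', hΛ', heq⟩ := hΛ.aestronglyMeasurable
  have h2 : Measurable (fun ω => if Λ' ω ≤ M then ℓ (v ω) ω else 0) :=
    Measurable.ite (measurableSet_le hΛ'.measurable measurable_const) h1 measurable_const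
  refine ⟨_, h2.stronglyMeasurable, ?_⟩
  filter_upwards [heq] with ω hω
  simp [truncLoss, hω]

theorem truncLoss_bound (ℓ : U → Ω → ℝ) (Λ : Ω → ℝ) (hdom : ∀ u ω, |ℓ u ω| ≤ Λ ω)
    (M : ℝ) (hM : 0 ≤ M) (v : Ω → U) (ω : Ω) : |truncLoss ℓ Λ M v ω| ≤ M := by
  unfold truncLoss
  split_ifs with h
  · exact (hdom _ _).trans h
  · simpa using hM

theorem barLoss_aesm (T S : Ω → Ω) (hY0 : obsFieldLE T S Y 0 ≤ m0)
    (ℓ : U → Ω → ℝ) (hℓ : Measurable fun p : U × Ω => ℓ p.1 p.2)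
    (Λ : Ω → ℝ) (hΛ : Integrable Λ P) (M : ℝ) (v : Ω → U) (hv : Measurable v) :
    AEStronglyMeasurable (barLoss P T S Y ℓ Λ M v) P :=
  (truncLoss_aesm P ℓ hℓ Λ hΛ M v hv).sub
    ((stronglyMeasurable_condExp.mono hY0).aestronglyMeasurable)

theorem barLoss_bound (T S : Ω → Ω)
    (ℓ : U → Ω → ℝ) (Λ : Ω → ℝ) (hdom : ∀ u ω, |ℓ u ω| ≤ Λ ω) (M : ℝ) (hM : 0 ≤ M)
    (v : Ω → U) : ∀ᵐ ω ∂P, |barLoss P T S Y ℓ Λ M v ω| ≤ 2 * M := by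
  have h1 : ∀ᵐ ω ∂P, |(P[truncLoss ℓ Λ M v | obsFieldLE T S Y 0]) ω| ≤ M :=
    ae_bdd_abs_condExp_of_ae_bdd_abs
      (ae_of_all _ fun ω => truncLoss_bound ℓ Λ hdom M hM v ω)
  filter_upwards [h1] with ω hω
  have h2 := truncLoss_bound ℓ Λ hdom M hM v ω
  unfold barLoss
  have := abs_sub (truncLoss ℓ Λ M v ω) ((P[truncLoss ℓ Λ M v | obsFieldLE T S Y 0]) ω)
  linarith

/-- The part of `Λ` above level `M`. -/
def tailPart (Λ : Ω → ℝ) (M : ℝ) (ω : Ω) : ℝ := if Λ ω ≤ M then 0 else Λ ω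

theorem tailPart_integrable (Λ : Ω → ℝ) (hΛ : Integrable Λ P) (M : ℝ) :
    Integrable (tailPart Λ M) P := by
  obtain ⟨Λ', hΛ', heq⟩ := hΛ.aestronglyMeasurable
  have h2 : Measurable (fun ω => if Λ' ω ≤ M then 0 else Λ' ω) :=
    Measurable.ite (measurableSet_le hΛ'.measurable measurable_const) measurable_const
      hΛ'.measurable
  refine hΛ.mono ⟨_, h2.stronglyMeasurable, ?_⟩ ?_
  · filter_upwards [heq] with ω hω
    simp [tailPart, hω]
  · refine ae_of_all _ fun ω => ?_
    unfold tailPart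
    split_ifs <;> simp

theorem tailPart_tendsto (Λ : Ω → ℝ) (hΛ : Integrable Λ P) :
    Tendsto (fun M : ℝ => ∫ ω, tailPart Λ M ω ∂P) atTop (𝓝 0) := by
  have h : Tendsto (fun M : ℝ => ∫ ω, tailPart Λ M ω ∂P) atTop (𝓝 (∫ _, (0 : ℝ) ∂P)) := by
    refine tendsto_integral_filter_of_dominated_convergence (fun ω => |Λ ω|) ?_ ?_ hΛ.abs ?_
    · exact Eventually.of_forall fun M => (tailPart_integrable P Λ hΛ M).aestronglyMeasurable
    · refine Eventually.of_forall fun M => ae_of_all _ fun ω => ?_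
      unfold tailPart
      split_ifs <;> simp
    · refine ae_of_all _ fun ω => ?_
      refine tendsto_const_nhds.congr' ?_
      filter_upwards [eventually_ge_atTop (Λ ω)] with M hM
      simp [tailPart, hM]
  simpa using h

theorem fixed_level_bound
    (T S : Ω → Ω) (hT : MeasurePreserving T P P) (hS : MeasurePreserving S P P)
    (hST : Function.LeftInverse S T) (hTS : Function.RightInverse S T)
    (ℓ : U → Ω → ℝ) (hℓ : Measurable fun p : U × Ω => ℓ p.1 p.2)
    (Λ : Ω → ℝ) (hΛ : Integrable Λ P) (hdom : ∀ u ω, |ℓ u ω| ≤ Λ ω)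
    (hY : Y ≤ m0) (u : ℕ → Ω → U) (hu : Admissible T S Y u)
    (M : ℝ) (hM : 0 ≤ M) (G : ℕ → Ω → ℝ)
    (hG : ∀ k : ℕ,
      IsEssSupFam P ((Un T S Y 0 : Set (Ω → U)) ×ˢ (Un T S Y 0 : Set (Ω → U)))
        (fun p ω =>
          |(P[(fun ω' => barLoss P T S Y ℓ Λ M p.1 (S^[k] ω') *
                barLoss P T S Y ℓ Λ M p.2 ω') | obsFieldLE T S Y 0]) ω|)
        (G k)) :
    (∃ B : ℝ, ∀ n : ℕ, ∫ ω, (n : ℝ)⁻¹ * ∑ k ∈ Finset.Icc 1 n, G k ω ∂P ≤ B) ∧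
    ∀ n : ℕ, ∫ ω, |(n : ℝ)⁻¹ * ∑ k ∈ Finset.Icc 1 n,
          (lossAt T S ℓ (k : ℤ) (u k) ω -
            (P[lossAt T S ℓ (k : ℤ) (u k) | obsFieldLE T S Y (k : ℤ)]) ω)| ∂P ≤
      2 * ∫ ω, tailPart Λ M ω ∂P + Real.sqrt ((n : ℝ)⁻¹ * (2 * M) ^ 2 +
        2 * ∫ ω, (n : ℝ)⁻¹ * ∑ k ∈ Finset.Icc 1 n, G k ω ∂P) := by
  have hY0 : ∀ n, obsFieldLE T S Y n ≤ m0 := obsFieldLE_le Y hT.measurable hS.measurable hY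
  -- the shifted decisions
  set v : ℕ → Ω → U := fun k => u k ∘ S^[k] with hvdef
  have hv : ∀ k, 1 ≤ k → v k ∈ (Un T S Y 0 : Set (Ω → U)) := by
    intro k hk
    have h1 : Measurable[obsField T S Y 0 k] (u k) := hu k hk
    have h2 : Measurable[obsField T S Y (-k) 0] (v k) := by
      refine h1.comp ?_
      rw [measurable_iff_comap_le]
      exact comap_obsField_le hST hTS Y k
    exact Set.mem_iUnion₂.2 ⟨-(k : ℤ), by simp, h2⟩
  have hUm : ∀ w ∈ (Un T S Y 0 : Set (Ω → U)), Measurable w := by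
    intro w hw
    obtain ⟨m, -, hm⟩ := Set.mem_iUnion₂.1 hw
    have hm' : Measurable[obsField T S Y m 0] w := hm
    exact hm'.mono (obsField_le Y hT.measurable hS.measurable hY m 0) le_rfl
  have hvm : ∀ k, 1 ≤ k → Measurable (v k) := fun k hk => hUm _ (hv k hk)
  have hTk : ∀ k, MeasurePreserving (T^[k]) P P := fun k => hT.iterate k
  have hSk : ∀ k, MeasurePreserving (S^[k]) P P := fun k => hS.iterate k
  have hTe : ∀ k, MeasurableEmbedding (T^[k]) := fun k =>
    MeasurableEmbedding.of_measurable_inverse (hTk k).measurable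
      (by rw [(hTS.iterate k).surjective.range_eq]; exact MeasurableSet.univ)
      (hSk k).measurable (hST.iterate k)
  -- products of bar losses
  have hprod_bd : ∀ (k : ℕ) (w w' : Ω → U), ∀ᵐ ω ∂P,
      |barLoss P T S Y ℓ Λ M w (S^[k] ω) * barLoss P T S Y ℓ Λ M w' ω| ≤ (2 * M) * (2 * M) := by
    intro k w w'
    filter_upwards [(hSk k).quasiMeasurePreserving.ae (barLoss_bound Y P T S ℓ Λ hdom M hM w),
      barLoss_bound Y P T S ℓ Λ hdom M hM w'] with ω h1 h2
    rw [abs_mul]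
    exact mul_le_mul h1 h2 (abs_nonneg _) (by linarith)
  have hGnn : ∀ k, ∀ᵐ ω ∂P, 0 ≤ G k ω := by
    intro k
    filter_upwards [(hG k).2.1 (v 1, v 1) ⟨hv 1 le_rfl, hv 1 le_rfl⟩] with ω hω
    exact (abs_nonneg _).trans hω
  have hGle : ∀ k, ∀ᵐ ω ∂P, G k ω ≤ (2 * M) * (2 * M) := by
    intro k
    refine (hG k).2.2 (fun _ => (2 * M) * (2 * M)) measurable_const ?_
    rintro ⟨w, w'⟩ -
    exact ae_bdd_abs_condExp_of_ae_bdd_abs (hprod_bd k w w')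
  have hGint : ∀ k, Integrable (G k) P := by
    intro k
    refine Integrable.of_bound (C := (2 * M) * (2 * M)) (hG k).1.aestronglyMeasurable ?_
    filter_upwards [hGnn k, hGle k] with ω h1 h2
    rw [Real.norm_eq_abs, abs_of_nonneg h1]
    exact h2
  have hGsum : ∀ n : ℕ, ∫ ω, (n : ℝ)⁻¹ * ∑ k ∈ Finset.Icc 1 n, G k ω ∂P =
      (n : ℝ)⁻¹ * ∑ k ∈ Finset.Icc 1 n, ∫ ω, G k ω ∂P := by
    intro n
    rw [integral_const_mul, integral_finsetSum]
    exact fun k _ => hGint k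
  refine ⟨⟨(2 * M) * (2 * M), fun n => ?_⟩, fun n => ?_⟩
  · rw [hGsum]
    have h1 : ∑ k ∈ Finset.Icc 1 n, ∫ ω, G k ω ∂P ≤ n * ((2 * M) * (2 * M)) := by
      have : ∀ k ∈ Finset.Icc 1 n, ∫ ω, G k ω ∂P ≤ (2 * M) * (2 * M) := by
        intro k _
        have := integral_mono_ae (hGint k) (integrable_const _) (hGle k)
        simpa using this
      refine (Finset.sum_le_sum this).trans ?_
      simp
    rcases Nat.eq_zero_or_pos n with rfl | hn
    · simp only [Nat.cast_zero, inv_zero, zero_mul]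
      positivity
    · have hn' : (0 : ℝ) < n := by exact_mod_cast hn
      rw [inv_mul_le_iff₀ hn']
      exact h1
  -- the martingale-like differences
  set X : ℕ → Ω → ℝ := fun k ω => barLoss P T S Y ℓ Λ M (v k) (T^[k] ω) with hXdef
  set D : ℕ → Ω → ℝ := fun k ω => lossAt T S ℓ (k : ℤ) (u k) ω -
            (P[lossAt T S ℓ (k : ℤ) (u k) | obsFieldLE T S Y (k : ℤ)]) ω with hDdef
  have hXm : ∀ k, 1 ≤ k → AEStronglyMeasurable (X k) P := fun k hk =>
    (barLoss_aesm Y P T S (hY0 0) ℓ hℓ Λ hΛ M (v k) (hvm k hk)).comp_measurePreserving (hTk k)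
  have hXb : ∀ k, 1 ≤ k → ∀ᵐ ω ∂P, |X k ω| ≤ 2 * M := fun k _ =>
    (hTk k).quasiMeasurePreserving.ae (barLoss_bound Y P T S ℓ Λ hdom M hM (v k))
  have hXint : ∀ k, 1 ≤ k → Integrable (X k) P := fun k hk =>
    Integrable.of_bound (hXm k hk) (2 * M) (hXb k hk)
  have hcov : ∀ j r, 1 ≤ j → 1 ≤ r → ∫ ω, X j ω * X (j + r) ω ∂P ≤ ∫ ω, G r ω ∂P := by
    intro j r hj hr
    set F : Ω → ℝ := fun ω => barLoss P T S Y ℓ Λ M (v j) (S^[r] ω) *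
      barLoss P T S Y ℓ Λ M (v (j + r)) ω with hF
    have h1 : ∫ ω, X j ω * X (j + r) ω ∂P = ∫ ω, F ω ∂P := by
      rw [← (hTk (j + r)).integral_comp (hTe (j + r)) F]
      refine integral_congr_ae (ae_of_all _ fun ω => ?_)
      have : S^[r] (T^[j + r] ω) = T^[j] ω := by
        rw [add_comm j r, Function.iterate_add_apply]
        exact hST.iterate r _
      simp only [hXdef, hF, this]
    rw [h1, ← integral_condExp (hY0 0)]
    refine integral_mono_ae integrable_condExp (hGint r) ?_
    filter_upwards [(hG r).2.1 (v j, v (j + r)) ⟨hv j hj, hv _ (by omega)⟩] with ω hω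
    exact (le_abs_self _).trans hω
  have hsm := second_moment_bound P X (2 * M) (fun r => ∫ ω, G r ω ∂P) hXm hXb
    (fun r _ => integral_nonneg_of_ae (hGnn r)) hcov n
  rw [← hGsum] at hsm
  have hX1 := Real.le_sqrt_of_sq_le hsm
  -- remainder
  have hlossm : ∀ k, 1 ≤ k → Integrable (fun ω => ℓ (v k ω) ω) P := by
    intro k hk
    have h1 : Measurable fun ω => ℓ (v k ω) ω := hℓ.comp ((hvm k hk).prodMk measurable_id)
    refine hΛ.mono h1.aestronglyMeasurable (ae_of_all _ fun ω => ?_)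
    rw [Real.norm_eq_abs, Real.norm_eq_abs]
    exact (hdom _ _).trans (le_abs_self _)
  have hlossAt : ∀ k : ℕ, lossAt T S ℓ (k : ℤ) (u k) = fun ω => ℓ (v k (T^[k] ω)) (T^[k] ω) := by
    intro k
    funext ω
    simp only [lossAt, iter_natCast, hvdef, Function.comp_apply]
    rw [hST.iterate k ω]
  have hlossI : ∀ k : ℕ, 1 ≤ k → Integrable (lossAt T S ℓ (k : ℤ) (u k)) P := by
    intro k hk
    rw [hlossAt]
    exact (hTk k).integrable_comp_of_integrable (hlossm k hk)
  have hDint : ∀ k, 1 ≤ k → Integrable (D k) P := fun k hk =>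
    (hlossI k hk).sub integrable_condExp
  have hR : ∀ k, 1 ≤ k → ∫ ω, |D k ω - X k ω| ∂P ≤ 2 * ∫ ω, tailPart Λ M ω ∂P := by
    intro k hk
    have hti : Integrable (truncLoss ℓ Λ M (v k)) P :=
      Integrable.of_bound (truncLoss_aesm P ℓ hℓ Λ hΛ M (v k) (hvm k hk)) M
        (ae_of_all _ fun ω => truncLoss_bound ℓ Λ hdom M hM (v k) ω)
    have hti' : Integrable (fun ω => truncLoss ℓ Λ M (v k) (T^[k] ω)) P :=
      (hTk k).integrable_comp_of_integrable hti
    have hce := condExp_comp_of_measurePreserving (obsFieldLE T S Y 0) P (T^[k]) (hTk k) (hTe k)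
      (hY0 0) (truncLoss ℓ Λ M (v k)) hti
    rw [comap_obsFieldLE hST hTS Y k] at hce
    set E : Ω → ℝ := lossAt T S ℓ (k : ℤ) (u k) - fun ω => truncLoss ℓ Λ M (v k) (T^[k] ω)
      with hE
    have hEI : Integrable E P := (hlossI k hk).sub hti'
    have hsub := condExp_sub (hlossI k hk) hti' (obsFieldLE T S Y (k : ℤ))
    have hDX : ∀ᵐ ω ∂P, |D k ω - X k ω| ≤
        |E ω| + |(P[E | obsFieldLE T S Y (k : ℤ)]) ω| := by
      filter_upwards [hce, hsub] with ω h1 h2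
      have : D k ω - X k ω = E ω - (P[E | obsFieldLE T S Y (k : ℤ)]) ω := by
        rw [hE, h2]
        simp only [hDdef, hXdef, barLoss, Pi.sub_apply]
        rw [h1]
        ring
      rw [this]
      exact abs_sub _ _
    have hEt : ∫ ω, |E ω| ∂P ≤ ∫ ω, tailPart Λ M ω ∂P := by
      rw [← (hTk k).integral_comp (hTe k) (tailPart Λ M)]
      refine integral_mono hEI.abs
        ((hTk k).integrable_comp_of_integrable (tailPart_integrable P Λ hΛ M)) fun ω => ?_
      simp only [hE, hlossAt, Pi.sub_apply, truncLoss, tailPart]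
      split_ifs
      · simp
      · simpa using hdom _ _
    calc ∫ ω, |D k ω - X k ω| ∂P
        ≤ ∫ ω, (|E ω| + |(P[E | obsFieldLE T S Y (k : ℤ)]) ω|) ∂P :=
          integral_mono_ae ((hDint k hk).sub (hXint k hk)).abs
            (hEI.abs.add integrable_condExp.abs) hDX
      _ = ∫ ω, |E ω| ∂P + ∫ ω, |(P[E | obsFieldLE T S Y (k : ℤ)]) ω| ∂P :=
          integral_add hEI.abs integrable_condExp.abs
      _ ≤ 2 * ∫ ω, tailPart Λ M ω ∂P := by
          have := integral_abs_condExp_le (μ := P) (m := obsFieldLE T S Y (k : ℤ)) E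
          linarith
  have htail0 : 0 ≤ ∫ ω, tailPart Λ M ω ∂P := by
    refine integral_nonneg fun ω => ?_
    simp only [tailPart, Pi.zero_apply]
    split_ifs
    · exact le_rfl
    · linarith
  have hIcc : ∀ k ∈ Finset.Icc 1 n, 1 ≤ k := fun k hk => (Finset.mem_Icc.1 hk).1
  have hpt : ∀ ω, |(n : ℝ)⁻¹ * ∑ k ∈ Finset.Icc 1 n, D k ω| ≤
      (n : ℝ)⁻¹ * ∑ k ∈ Finset.Icc 1 n, |D k ω - X k ω| +
        |(n : ℝ)⁻¹ * ∑ k ∈ Finset.Icc 1 n, X k ω| := by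
    intro ω
    have h1 : (n : ℝ)⁻¹ * ∑ k ∈ Finset.Icc 1 n, D k ω =
        (n : ℝ)⁻¹ * ∑ k ∈ Finset.Icc 1 n, (D k ω - X k ω) +
        (n : ℝ)⁻¹ * ∑ k ∈ Finset.Icc 1 n, X k ω := by
      rw [← mul_add, ← Finset.sum_add_distrib]
      congr 1
      exact Finset.sum_congr rfl fun k _ => by ring
    rw [h1]
    refine (abs_add_le _ _).trans ?_
    gcongr
    rw [abs_mul, abs_of_nonneg (by positivity : (0 : ℝ) ≤ (n : ℝ)⁻¹)]
    gcongr
    exact Finset.abs_sum_le_sum_abs _ _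
  have hi1 : Integrable (fun ω => (n : ℝ)⁻¹ * ∑ k ∈ Finset.Icc 1 n, |D k ω - X k ω|) P :=
    (integrable_finsetSum _ fun k hk =>
      ((hDint k (hIcc k hk)).sub (hXint k (hIcc k hk))).abs).const_mul _
  have hi2 : Integrable (fun ω => |(n : ℝ)⁻¹ * ∑ k ∈ Finset.Icc 1 n, X k ω|) P :=
    ((integrable_finsetSum _ fun k hk => hXint k (hIcc k hk)).const_mul _).abs
  have hi3 : Integrable (fun ω => |(n : ℝ)⁻¹ * ∑ k ∈ Finset.Icc 1 n, D k ω|) P :=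
    ((integrable_finsetSum _ fun k hk => hDint k (hIcc k hk)).const_mul _).abs
  refine (integral_mono hi3 (hi1.add hi2) hpt).trans ?_
  have hadd := integral_add hi1 hi2
  simp only [Pi.add_apply]
  rw [hadd]
  refine add_le_add ?_ hX1
  rw [integral_const_mul]
  rw [integral_finsetSum (Finset.Icc 1 n) (f := fun k ω => |D k ω - X k ω|) fun k hk =>
    ((hDint k (hIcc k hk)).sub (hXint k (hIcc k hk))).abs]
  have h1 : ∑ k ∈ Finset.Icc 1 n, ∫ ω, |D k ω - X k ω| ∂P ≤
      n * (2 * ∫ ω, tailPart Λ M ω ∂P) := by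
    refine (Finset.sum_le_sum fun k hk => hR k (hIcc k hk)).trans ?_
    simp
  rcases Nat.eq_zero_or_pos n with hn | hn
  · subst hn
    simp only [Nat.cast_zero, inv_zero, zero_mul]
    positivity
  · have hn' : (0 : ℝ) < n := by exact_mod_cast hn
    rw [inv_mul_le_iff₀ hn']
    exact h1

end Main

/-- Lemma 4.5: under the uniform conditional mixing assumption, the Cesàro
averages of `ℓ_k(u_k) − E[ℓ_k(u_k)|𝒴_{-∞,k}]` converge to `0` in `L¹(P)` for every admissible
strategy `u`. -/
theorem statement17
    {Ω U : Type*} [m0 : MeasurableSpace Ω] [MeasurableSpace U]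
    (P : Measure Ω) [IsProbabilityMeasure P]
    (T S : Ω → Ω) (hT : Ergodic T P) (hS : MeasurePreserving S P P)
    (hST : Function.LeftInverse S T) (hTS : Function.RightInverse S T)
    (ℓ : U → Ω → ℝ) (hℓ : Measurable fun p : U × Ω => ℓ p.1 p.2)
    (Λ : Ω → ℝ) (hΛ : Integrable Λ P) (hdom : ∀ u ω, |ℓ u ω| ≤ Λ ω)
    (Y : MeasurableSpace Ω) (hY : Y ≤ m0)
    (hmix : UniformCondMixing P T S Y ℓ Λ)
    (u : ℕ → Ω → U) (hu : Admissible T S Y u) :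
    Tendsto (fun n : ℕ => ∫ ω,
        |(n : ℝ)⁻¹ * ∑ k ∈ Finset.Icc 1 n,
          (lossAt T S ℓ (k : ℤ) (u k) ω -
            (P[lossAt T S ℓ (k : ℤ) (u k) | obsFieldLE T S Y (k : ℤ)]) ω)| ∂P)
      atTop (𝓝 0) := by
  obtain ⟨G, hG, hlim⟩ := hmix
  have hbd := fun (M : ℝ) (hM : 0 ≤ M) => fixed_level_bound (m0 := m0) Y P T S hT.toMeasurePreserving hS
    hST hTS ℓ hℓ Λ hΛ hdom hY u hu M hM (G M) (hG M)
  rw [Metric.tendsto_atTop]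
  intro ε hε
  have hδ : 0 < ε ^ 2 / 32 := by positivity
  have e1 := hlim.eventually (gt_mem_nhds hδ)
  have e2 := (tailPart_tendsto (m0 := m0) P Λ hΛ).eventually (gt_mem_nhds (by positivity : 0 < ε / 4))
  obtain ⟨M, ⟨hM1, hM2⟩, hM0⟩ := ((e1.and e2).and (eventually_ge_atTop (0 : ℝ))).exists
  obtain ⟨⟨B, hB⟩, hn⟩ := hbd M hM0
  have e3 := eventually_lt_of_limsup_lt hM1 ⟨B, eventually_map.2 (Eventually.of_forall hB)⟩
  have e4 : Tendsto (fun n : ℕ => (n : ℝ)⁻¹ * (2 * M) ^ 2) atTop (𝓝 0) := by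
    simpa using (tendsto_inv_atTop_nhds_zero_nat (𝕜 := ℝ)).mul_const ((2 * M) ^ 2)
  have e5 := e4.eventually (gt_mem_nhds (by positivity : 0 < ε ^ 2 / 16))
  obtain ⟨N, hN⟩ := eventually_atTop.1 (e3.and e5)
  refine ⟨N, fun n hnN => ?_⟩
  obtain ⟨h1, h2⟩ := hN n hnN
  rw [Real.dist_eq, sub_zero, abs_of_nonneg (integral_nonneg fun ω => abs_nonneg _)]
  refine (hn n).trans_lt ?_
  have h3 : Real.sqrt ((n : ℝ)⁻¹ * (2 * M) ^ 2 +
      2 * ∫ ω, (n : ℝ)⁻¹ * ∑ k ∈ Finset.Icc 1 n, G M k ω ∂P) < ε / 2 := by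
    rw [Real.sqrt_lt' (by positivity)]
    have : (ε / 2) ^ 2 = ε ^ 2 / 4 := by ring
    nlinarith [sq_nonneg ε]
  linarith

end ErgodicDecisions
end
end
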